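/- arXiv:1305.5490 — 8 statements merged into one kernel-verified Lean document; each statement's English description precedes it below -/
import Mathlib

section
/- Let γ be a continuous strictly increasing function on [0,∞), let λ_γ be its Lebesgue–Stieltjes measure, let 0 ≤ a < b, 1 ≤ p ≤ ∞, and let r ≥ 1 be an integer. If f is r-times γ-relative differentiable on (a,b) and f, f_γ^{(r)} ∈ L^p((a,b), λ_γ), then for every 0 ≤ k ≤ r there is a constant M(r,k), independent of p and of the interval [a,b], such that ‖f_γ^{(k)}‖_{L^p((a,b),λ_γ)} ≤ M(r,k) ‖f‖_{L^p((a,b),λ_γ)} (γ(b) − γ(a))^{−k} + M(r,k) ‖f_γ^{(r)}‖_{L^p((a,b),λ_γ)} (γ(b) − γ(a))^{r−k}. -/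
open MeasureTheory Filter Set Topology
open scoped ENNReal NNReal

noncomputable section

/-- The Laguerre weight `w_α(x) = x^α e^{-x}`. -/
def lagWeight (α x : ℝ) : ℝ := x ^ α * Real.exp (-x)

/-- `f` has γ-relative derivative `L` at `x₀`, i.e.
`lim_{h→0} (f(x₀+h) - f(x₀)) / (γ(x₀+h) - γ(x₀)) = L`. -/
def HasGDerivAt (γ f : ℝ → ℝ) (L x₀ : ℝ) : Prop :=
  Tendsto (fun x => (f x - f x₀) / (γ x - γ x₀)) (𝓝[≠] x₀) (𝓝 L)

/-- The γ-relative derivative of `f` at `x₀` (junk value if the limit does not exist). -/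
def gDeriv (γ f : ℝ → ℝ) (x₀ : ℝ) : ℝ :=
  limUnder (𝓝[≠] x₀) (fun x => (f x - f x₀) / (γ x - γ x₀))

/-- Iterated γ-relative derivative `f_γ^{(n)}`. -/
def gIter (γ f : ℝ → ℝ) : ℕ → ℝ → ℝ
  | 0 => f
  | n + 1 => gDeriv γ (gIter γ f n)

/-- `f` is `n`-times γ-relative differentiable on `s`. -/
def GDiffOn (γ f : ℝ → ℝ) (n : ℕ) (s : Set ℝ) : Prop :=
  ∀ k < n, ∀ x ∈ s, HasGDerivAt γ (gIter γ f k) (gIter γ f (k + 1) x) x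

/-- The piecewise-power part `γ₀` of the function `γ`. -/
def gamma0 (N : ℕ) (a β : ℕ → ℝ) (x : ℝ) : ℝ :=
  (∑ k ∈ Finset.range N, |x - a k| ^ β k * Real.sign (x - a k))
    + ∑ k ∈ Finset.range N, a k ^ β k

/-- The constant `𝒞₁`. -/
def gammaC1 (N : ℕ) (a β : ℕ → ℝ) : ℝ :=
  ∑ k ∈ Finset.range N, β k * (a (N - 1) + 1 - a k) ^ (β k - 1)

/-- The constant `𝒞₂`. -/
def gammaC2 (N : ℕ) (a β : ℕ → ℝ) : ℝ :=
  (∑ k ∈ Finset.range N, (a (N - 1) + 1 - a k) ^ β k)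
    - gammaC1 N a β * (a (N - 1) + 1) + ∑ k ∈ Finset.range N, a k ^ β k

/-- The piecewise-power function `γ` of the paper (formula (3)). -/
def gammaFun (N : ℕ) (a β : ℕ → ℝ) (x : ℝ) : ℝ :=
  if x ≤ a (N - 1) + 1 then gamma0 N a β x else gammaC1 N a β * x + gammaC2 N a β

/-- The inverse of `γ` (on `[0,∞)`). -/
def gammaInv (γ : ℝ → ℝ) (y : ℝ) : ℝ := Function.invFunOn γ (Ici 0) y

/-- The weighted `L^p` norm `‖f w_α‖_{L^p(I)}` with respect to a measure `μ`. -/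
def wnorm (μ : Measure ℝ) (p : ℝ≥0∞) (α : ℝ) (I : Set ℝ) (f : ℝ → ℝ) : ℝ≥0∞ :=
  eLpNorm (fun x => f x * lagWeight α x) p (μ.restrict I)

/-- Membership in the weighted Sobolev space `W^{r,p}_γ(I)`. -/
def memW (μ : Measure ℝ) (γ : ℝ → ℝ) (r : ℕ) (p : ℝ≥0∞) (α : ℝ) (I : Set ℝ)
    (g : ℝ → ℝ) : Prop :=
  wnorm μ p α I g < ⊤ ∧ GDiffOn γ g r I ∧
    wnorm μ p α I (fun x => gIter γ g r x * Real.sqrt x ^ r) < ⊤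

/-- The weighted γ-K-functional `K_{γ,r,φ}(f, t^r, L^p_{w_α}(I), W^{r,p}_γ(I))`. -/
def Kfun (μ : Measure ℝ) (γ : ℝ → ℝ) (r : ℕ) (p : ℝ≥0∞) (α : ℝ) (I : Set ℝ)
    (f : ℝ → ℝ) (t : ℝ) : ℝ≥0∞ :=
  ⨅ g ∈ {g : ℝ → ℝ | memW μ γ r p α I g},
    wnorm μ p α I (fun x => f x - g x)
      + ENNReal.ofReal (t ^ r) * wnorm μ p α I (fun x => gIter γ g r x * Real.sqrt x ^ r)

/-- The interval `I_{rh,γ} = [4A₁r²(γ⁻¹(h))², A₂/(γ⁻¹(h))²]`. -/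
def Irh (γ : ℝ → ℝ) (r : ℕ) (A1 A2 h : ℝ) : Set ℝ :=
  Icc (4 * A1 * (r : ℝ) ^ 2 * gammaInv γ h ^ 2) (A2 / gammaInv γ h ^ 2)

/-- The restricted γ-K-functional `K̃_{γ,r,φ}(f, t^r, L^p_{w_α}, W^{r,p}_γ)`. -/
def Ktilde (μ : Measure ℝ) (γ : ℝ → ℝ) (r : ℕ) (p : ℝ≥0∞) (α A1 A2 : ℝ)
    (f : ℝ → ℝ) (t : ℝ) : ℝ≥0∞ :=
  ⨆ h ∈ Ioc (0 : ℝ) t, Kfun μ γ r p α (Irh γ r A1 A2 h) f h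

/-- The forward difference `Δ⃗^r_{γ,φ,h} f(x)`. -/
def gDelta (γ : ℝ → ℝ) (r : ℕ) (h : ℝ) (f : ℝ → ℝ) (x : ℝ) : ℝ :=
  ∑ k ∈ Finset.range (r + 1),
    (-1 : ℝ) ^ (r - k) * (r.choose k : ℝ) * f (x + k * gammaInv γ h * Real.sqrt x)

/-- The main part of the γ-modulus of smoothness `Ω^r_{γ,φ}(f,t)_{w_α,p}`. -/
def Omega (μ : Measure ℝ) (γ : ℝ → ℝ) (r : ℕ) (p : ℝ≥0∞) (α A1 A2 : ℝ)
    (f : ℝ → ℝ) (t : ℝ) : ℝ≥0∞ :=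
  ⨆ h ∈ Ioc (0 : ℝ) t, wnorm μ p α (Irh γ r A1 A2 h) (gDelta γ r h f)

/-- The complete γ-modulus of smoothness `ω^r_{γ,φ}(f,t)_{w_α,p}`. -/
def omegaFull (μ : Measure ℝ) (γ : ℝ → ℝ) (r : ℕ) (p : ℝ≥0∞) (α A1 A2 : ℝ)
    (f : ℝ → ℝ) (t : ℝ) : ℝ≥0∞ :=
  Omega μ γ r p α A1 A2 f t
    + ⨅ q ∈ {q : Polynomial ℝ | q.degree < (r : ℕ)},
        wnorm μ p α (Ioo 0 (4 * A1 * (r : ℝ) ^ 2 * gammaInv γ t ^ 2))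
          (fun x => f x - q.eval (γ x))
    + ⨅ q ∈ {q : Polynomial ℝ | q.degree < (r : ℕ)},
        wnorm μ p α (Ioi (A2 / gammaInv γ t ^ 2)) (fun x => f x - q.eval (γ x))


/-- Some value of the `k`-th derivative is controlled by the `L¹` norm of the function. -/
theorem exists_abs_deriv_le (k : ℕ) : ∃ C : ℝ, 0 < C ∧ ∀ (G : ℕ → ℝ → ℝ) (A B N : ℝ), A < B →
    (∀ j < k, ∀ y ∈ Ioo A B, HasDerivAt (G j) (G (j + 1) y) y) →
    IntegrableOn (G 0) (Ioo A B) → ∫ y in Ioo A B, |G 0 y| ≤ N →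
    ∃ ξ ∈ Ioo A B, |G k ξ| ≤ C * ((B - A) ^ (k + 1))⁻¹ * N := by
  induction k with
  | zero =>
    refine ⟨1, one_pos, fun G A B N hAB _ hint hN => ?_⟩
    obtain ⟨ξ, hξ, h⟩ := exists_le_setAverage (μ := volume) (s := Ioo A B) (f := fun y => |G 0 y|)
      (by simp [hAB]) (by simp) hint.abs
    refine ⟨ξ, hξ, h.trans ?_⟩
    have hL : 0 < B - A := sub_pos.2 hAB
    rw [setAverage_eq]
    simp only [measureReal_def, Real.volume_Ioo, ENNReal.toReal_ofReal hL.le, smul_eq_mul, zero_add,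
      pow_one, one_mul]
    gcongr
  | succ k ih =>
    obtain ⟨C, hC, ih⟩ := ih
    refine ⟨2 * C * 3 ^ (k + 2), by positivity, fun G A B N hAB hG hint hN => ?_⟩
    have hL : 0 < B - A := sub_pos.2 hAB
    obtain ⟨D, hD⟩ : ∃ D, D = (B - A) / 3 := ⟨_, rfl⟩
    have hD0 : 0 < D := by linarith
    have sub : ∀ u v, A ≤ u → v ≤ B → v - u = D →
        ∃ ξ ∈ Ioo u v, |G k ξ| ≤ C * (D ^ (k + 1))⁻¹ * N := by
      intro u v hu hv huv
      have hss : Ioo u v ⊆ Ioo A B := Ioo_subset_Ioo hu hv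
      have := ih G u v N (by linarith) (fun j hj y hy => hG j (by omega) y (hss hy))
        (hint.mono_set hss) ((setIntegral_mono_set hint.abs
          (Eventually.of_forall fun _ => abs_nonneg _) hss.eventuallyLE).trans hN)
      rwa [huv] at this
    obtain ⟨s, hs, hs'⟩ := sub A (A + D) le_rfl (by linarith) (by ring)
    obtain ⟨t, ht, ht'⟩ := sub (B - D) B (by linarith) le_rfl (by ring)
    have hst : D < t - s := by linarith [hs.2, ht.1]
    have hin : ∀ y ∈ Icc s t, y ∈ Ioo A B := fun y hy =>
      ⟨hs.1.trans_le hy.1, hy.2.trans_lt ht.2⟩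
    obtain ⟨ξ, hξ, h⟩ := exists_hasDerivAt_eq_slope (G k) (G (k + 1)) (by linarith : s < t)
      (fun y hy => (hG k (by omega) y (hin y hy)).continuousAt.continuousWithinAt)
      (fun y hy => hG k (by omega) y (hin y (Ioo_subset_Icc_self hy)))
    refine ⟨ξ, hin ξ (Ioo_subset_Icc_self hξ), ?_⟩
    rw [h, abs_div, abs_of_pos (hD0.trans hst)]
    have h1 : |G k t - G k s| ≤ 2 * (C * (D ^ (k + 1))⁻¹ * N) :=
      (abs_sub _ _).trans (by linarith)
    have h2 : B - A = 3 * D := by rw [hD]; ring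
    calc |G k t - G k s| / (t - s) ≤ 2 * (C * (D ^ (k + 1))⁻¹ * N) / D := by
          gcongr
          exact (abs_nonneg _).trans h1
      _ = _ := by
          rw [h2, mul_pow]
          field_simp
          ring

theorem abs_sub_le_of_hasDerivAt {F F' : ℝ → ℝ} {A B x ξ K : ℝ} (hx : x ∈ Ioo A B)
    (hξ : ξ ∈ Ioo A B) (hF : ∀ y ∈ Ioo A B, HasDerivAt F (F' y) y)
    (hK : ∀ y ∈ Ioo A B, |F' y| ≤ K) : |F x - F ξ| ≤ K * (B - A) := by
  have h := (convex_Ioo A B).norm_image_sub_le_of_norm_hasDerivWithin_le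
    (fun y hy => (hF y hy).hasDerivWithinAt) hK hξ hx
  refine h.trans ?_
  have : |x - ξ| ≤ B - A := abs_le.2 ⟨by linarith [hx.1, hξ.2], by linarith [hx.2, hξ.1]⟩
  have := (abs_nonneg _).trans (hK x hx)
  rw [Real.norm_eq_abs]
  gcongr

theorem abs_sub_le_integral_of_hasDerivAt {F F' : ℝ → ℝ} {A B x ξ : ℝ} (hx : x ∈ Ioo A B)
    (hξ : ξ ∈ Ioo A B) (hF : ∀ y ∈ Ioo A B, HasDerivAt F (F' y) y)
    (hint : IntegrableOn F' (Ioo A B)) : |F x - F ξ| ≤ ∫ y in Ioo A B, |F' y| := by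
  have hsub : uIcc ξ x ⊆ Ioo A B := ordConnected_Ioo.uIcc_subset hξ hx
  have hsub' := uIoc_subset_uIcc.trans hsub
  rw [← intervalIntegral.integral_eq_sub_of_hasDerivAt (fun y hy => hF y (hsub hy))
    (intervalIntegrable_iff.2 (hint.mono_set hsub'))]
  exact (intervalIntegral.norm_integral_le_integral_norm_uIoc).trans
    (setIntegral_mono_set hint.norm (Eventually.of_forall fun _ => norm_nonneg _)
      hsub'.eventuallyLE)

/-- Pointwise bound of the `k`-th derivative by the `L¹` norms of the function and of its
derivative of order `k + d + 1`. -/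
theorem exists_abs_deriv_le_integral (d : ℕ) : ∀ k : ℕ, ∃ M : ℝ, 0 < M ∧
    ∀ (G : ℕ → ℝ → ℝ) (A B : ℝ), A < B →
    (∀ j < k + d + 1, ∀ y ∈ Ioo A B, HasDerivAt (G j) (G (j + 1) y) y) →
    IntegrableOn (G 0) (Ioo A B) → IntegrableOn (G (k + d + 1)) (Ioo A B) →
    ∀ x ∈ Ioo A B, |G k x| ≤ M * ((B - A) ^ (k + 1))⁻¹ * (∫ y in Ioo A B, |G 0 y|)
      + M * (B - A) ^ d * ∫ y in Ioo A B, |G (k + d + 1) y| := by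
  induction d with
  | zero =>
    intro k
    obtain ⟨C, hC, hCk⟩ := exists_abs_deriv_le k
    refine ⟨C + 1, by positivity, fun G A B hAB hG h0 hr x hx => ?_⟩
    obtain ⟨ξ, hξ, h⟩ := hCk G A B _ hAB (fun j hj => hG j (by omega)) h0 le_rfl
    have h1 := abs_sub_le_integral_of_hasDerivAt hx hξ (hG k (by omega)) hr
    have h2 := abs_sub_abs_le_abs_sub (G k x) (G k ξ)
    have hL : 0 < B - A := sub_pos.2 hAB
    have i0 : 0 ≤ ∫ y in Ioo A B, |G 0 y| := integral_nonneg fun _ => abs_nonneg _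
    have i1 : 0 ≤ ∫ y in Ioo A B, |G (k + 1) y| := integral_nonneg fun _ => abs_nonneg _
    have i2 : 0 ≤ ((B - A) ^ (k + 1))⁻¹ * ∫ y in Ioo A B, |G 0 y| := by positivity
    simp only [add_zero, pow_zero, mul_one] at *
    nlinarith [mul_nonneg hC.le i1]
  | succ d ih =>
    intro k
    obtain ⟨C, hC, hCk⟩ := exists_abs_deriv_le k
    obtain ⟨M, hM, hMk⟩ := ih (k + 1)
    refine ⟨C + M, by positivity, fun G A B hAB hG h0 hr x hx => ?_⟩
    have e : k + 1 + d + 1 = k + (d + 1) + 1 := by ring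
    rw [e] at hMk
    obtain ⟨ξ, hξ, h⟩ := hCk G A B _ hAB (fun j hj => hG j (by omega)) h0 le_rfl
    have h1 := abs_sub_le_of_hasDerivAt hx hξ (hG k (by omega)) (hMk G A B hAB hG h0 hr)
    have h2 := abs_sub_abs_le_abs_sub (G k x) (G k ξ)
    have hL : 0 < B - A := sub_pos.2 hAB
    have i1 : 0 ≤ (B - A) ^ (d + 1) * ∫ y in Ioo A B, |G (k + (d + 1) + 1) y| :=
      mul_nonneg (by positivity) (integral_nonneg fun _ => abs_nonneg _)
    have h3 : ((B - A) ^ (k + 1 + 1))⁻¹ * (B - A) = ((B - A) ^ (k + 1))⁻¹ := by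
      field_simp
      ring
    have h4 : (B - A) ^ d * (B - A) = (B - A) ^ (d + 1) := by ring
    have h5 : (M * ((B - A) ^ (k + 1 + 1))⁻¹ * (∫ y in Ioo A B, |G 0 y|)
      + M * (B - A) ^ d * ∫ y in Ioo A B, |G (k + (d + 1) + 1) y|) * (B - A)
      = M * ((B - A) ^ (k + 1))⁻¹ * (∫ y in Ioo A B, |G 0 y|)
      + M * (B - A) ^ (d + 1) * ∫ y in Ioo A B, |G (k + (d + 1) + 1) y| := by
      rw [← h3, ← h4]; ring
    nlinarith [mul_nonneg hC.le i1]

/-- The Landau–Kolmogorov type inequality for ordinary derivatives on a bounded interval. -/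
theorem exists_eLpNorm_deriv_le (k d : ℕ) : ∃ M : ℝ, 0 < M ∧
    ∀ (G : ℕ → ℝ → ℝ) (A B : ℝ), A < B → ∀ p : ℝ≥0∞, 1 ≤ p →
    (∀ j < k + d + 1, ∀ y ∈ Ioo A B, HasDerivAt (G j) (G (j + 1) y) y) →
    eLpNorm (G 0) p (volume.restrict (Ioo A B)) < ⊤ →
    eLpNorm (G (k + d + 1)) p (volume.restrict (Ioo A B)) < ⊤ →
    eLpNorm (G k) p (volume.restrict (Ioo A B)) ≤
      ENNReal.ofReal (M * ((B - A) ^ k)⁻¹) * eLpNorm (G 0) p (volume.restrict (Ioo A B)) +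
      ENNReal.ofReal (M * (B - A) ^ (d + 1)) *
        eLpNorm (G (k + d + 1)) p (volume.restrict (Ioo A B)) := by
  obtain ⟨M, hM, hMk⟩ := exists_abs_deriv_le_integral d k
  refine ⟨M, hM, fun G A B hAB p hp hG h0 hr => ?_⟩
  have hL : 0 < B - A := sub_pos.2 hAB
  set ν := volume.restrict (Ioo A B) with hν
  have hν1 : ν univ = ENNReal.ofReal (B - A) := by simp [hν]
  have m0 : AEStronglyMeasurable (G 0) ν := ContinuousOn.aestronglyMeasurable
    (fun y hy => (hG 0 (by omega) y hy).continuousAt.continuousWithinAt) measurableSet_Ioo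
  have mr : AEStronglyMeasurable (G (k + d + 1)) ν := by
    refine (measurable_deriv (G (k + d))).aestronglyMeasurable.congr ?_
    filter_upwards [ae_restrict_mem measurableSet_Ioo] with y hy
    exact (hG (k + d) (by omega) y hy).deriv
  have key : ∀ F : ℝ → ℝ, AEStronglyMeasurable F ν → eLpNorm F p ν < ⊤ → Integrable F ν ∧
      ν univ ^ p.toReal⁻¹ * ENNReal.ofReal (∫ y, |F y| ∂ν) ≤
        ENNReal.ofReal (B - A) * eLpNorm F p ν := by
    intro F hF hFp
    have hi : Integrable F ν := MemLp.integrable hp ⟨hF, hFp⟩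
    refine ⟨hi, ?_⟩
    have e1 : ENNReal.ofReal (∫ y, |F y| ∂ν) = eLpNorm F 1 ν := by
      rw [eLpNorm_one_eq_lintegral_enorm]
      exact ofReal_integral_norm_eq_lintegral_enorm hi
    rw [e1]
    refine (mul_le_mul_right (eLpNorm_le_eLpNorm_mul_rpow_measure_univ hp hF) _).trans_eq ?_
    rw [mul_left_comm, hν1, ← ENNReal.rpow_add _ _ (by simpa using hAB) (by simp), mul_comm]
    simp
  obtain ⟨i0, n0⟩ := key _ m0 h0
  obtain ⟨ir, nr⟩ := key _ mr hr
  have hb : ∀ᵐ y ∂ν, ‖G k y‖ ≤ M * ((B - A) ^ (k + 1))⁻¹ * (∫ y in Ioo A B, |G 0 y|)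
      + M * (B - A) ^ d * ∫ y in Ioo A B, |G (k + d + 1) y| := by
    filter_upwards [ae_restrict_mem measurableSet_Ioo] with y hy
    exact hMk G A B hAB hG i0 ir y hy
  have j0 : 0 ≤ ∫ y, |G 0 y| ∂ν := integral_nonneg fun _ => abs_nonneg _
  have jr : 0 ≤ ∫ y, |G (k + d + 1) y| ∂ν := integral_nonneg fun _ => abs_nonneg _
  refine (eLpNorm_le_of_ae_bound hb).trans ?_
  rw [ENNReal.ofReal_add (by positivity) (by positivity), mul_add,
    ENNReal.ofReal_mul (by positivity), ENNReal.ofReal_mul (q := ∫ y, _ ∂ν) (by positivity),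
    mul_left_comm, mul_left_comm _ (ENNReal.ofReal (M * _ ^ d))]
  refine (add_le_add (mul_le_mul_right n0 _) (mul_le_mul_right nr _)).trans_eq ?_
  rw [← mul_assoc, ← mul_assoc, ← ENNReal.ofReal_mul (by positivity),
    ← ENNReal.ofReal_mul (by positivity)]
  congr 3
  · field_simp
    ring
  · ring

/-- A function that is continuous and strictly increasing on `[a, b]` extends to an order
isomorphism of `ℝ`. -/
theorem exists_orderIso_eqOn_Icc {γ : ℝ → ℝ} {a b : ℝ} (hab : a ≤ b)
    (hγ : StrictMonoOn γ (Icc a b)) (hc : ContinuousOn γ (Icc a b)) :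
    ∃ e : ℝ ≃o ℝ, EqOn e γ (Icc a b) := by
  let g : ℝ → ℝ := fun x => γ (projIcc a b hab x) + (x - projIcc a b hab x)
  have hgc : Continuous g :=
    (hc.comp_continuous (continuous_subtype_val.comp continuous_projIcc)
      fun x => (projIcc a b hab x).2).add
      (continuous_id.sub (continuous_subtype_val.comp continuous_projIcc))
  have hgm : StrictMono g := by
    intro x y hxy
    have h1 : projIcc a b hab x ≤ projIcc a b hab y := monotone_projIcc hab hxy.le
    have h2 : (projIcc a b hab y : ℝ) - projIcc a b hab x ≤ y - x := by
      simp only [coe_projIcc]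
      rcases max_cases a (min b y) with h | h <;> rcases max_cases a (min b x) with h' | h' <;>
      rcases min_cases b y with h3 | h3 <;> rcases min_cases b x with h4 | h4 <;> linarith
    rcases h1.eq_or_lt with h | h
    · simp only [g, h]
      linarith
    · have := hγ (projIcc a b hab x).2 (projIcc a b hab y).2 h
      simp only [g]
      linarith
  have htop : Tendsto g atTop atTop := by
    refine tendsto_atTop_mono' _ ?_ (tendsto_atTop_add_const_right _ (γ b - b) tendsto_id)
    filter_upwards [eventually_ge_atTop b] with x hx
    simp only [g, projIcc_of_right_le hab hx, id]
    linarith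
  have hbot : Tendsto g atBot atBot := by
    refine tendsto_atBot_mono' _ ?_ (tendsto_atBot_add_const_right _ (γ a - a) tendsto_id)
    filter_upwards [eventually_le_atBot a] with x hx
    simp only [g, projIcc_of_le_left hab hx, id]
    linarith
  refine ⟨hgm.orderIsoOfSurjective g (hgc.surjective htop hbot), fun x hx => ?_⟩
  simp [g, projIcc_of_mem hab hx]

/-- The Lebesgue–Stieltjes measure of `γ` on `(a, b)` is the image of Lebesgue measure under the
inverse of `γ`. -/
theorem map_symm_volume_restrict_Ioo {γ : ℝ → ℝ} {a b : ℝ} (e : ℝ ≃o ℝ)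
    (he : EqOn e γ (Icc a b)) (μ : Measure ℝ)
    (hμ : ∀ c d : ℝ, a ≤ c → c ≤ d → d ≤ b → μ (Ioc c d) = ENNReal.ofReal (γ d - γ c)) :
    μ.restrict (Ioo a b) = (volume.restrict (Ioo (e a) (e b))).map e.symm := by
  have hm : Measurable e.symm := e.symm.continuous.measurable
  have h : μ.restrict (Ioc a b) = (volume.map e.symm).restrict (Ioc a b) := by
    have key : ∀ c d : ℝ, μ.restrict (Ioc a b) (Ioc c d) =
        (volume.map e.symm).restrict (Ioc a b) (Ioc c d) ∧
        μ.restrict (Ioc a b) (Ioc c d) ≠ ⊤ := by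
      intro c d
      rw [Measure.restrict_apply measurableSet_Ioc, Measure.restrict_apply measurableSet_Ioc,
        Ioc_inter_Ioc]
      rcases le_total (d ⊓ b) (c ⊔ a) with hle | hle
      · simp [Ioc_eq_empty_of_le hle]
      · have h1 : c ⊔ a ∈ Icc a b := ⟨le_sup_right, hle.trans inf_le_right⟩
        have h2 : d ⊓ b ∈ Icc a b := ⟨le_sup_right.trans hle, inf_le_right⟩
        rw [hμ _ _ h1.1 hle h2.2, Measure.map_apply hm measurableSet_Ioc,
          OrderIso.preimage_Ioc, Real.volume_Ioc, OrderIso.symm_symm, he h1, he h2]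
        exact ⟨rfl, ENNReal.ofReal_ne_top⟩
    exact Measure.ext_of_Ioc' _ _ (fun c d _ => (key c d).2) (fun c d _ => (key c d).1)
  have h' : (μ.restrict (Ioc a b)).restrict (Ioo a b) = _ :=
    congrArg (fun m => Measure.restrict m (Ioo a b)) h
  rw [Measure.restrict_restrict measurableSet_Ioo, Measure.restrict_restrict measurableSet_Ioo,
    inter_eq_left.2 (Ioo_subset_Ioc_self : Ioo a b ⊆ Ioc a b)] at h'
  rw [h', Measure.restrict_map hm measurableSet_Ioo, OrderIso.preimage_Ioo, OrderIso.symm_symm]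

theorem HasGDerivAt.hasDerivAt_comp_symm {γ F : ℝ → ℝ} {a b L y : ℝ} (e : ℝ ≃o ℝ)
    (he : EqOn e γ (Icc a b)) (hy : y ∈ Ioo (e a) (e b)) (h : HasGDerivAt γ F L (e.symm y)) :
    HasDerivAt (F ∘ e.symm) L y := by
  have hmem : ∀ z ∈ Ioo (e a) (e b), γ (e.symm z) = z := fun z hz => by
    rw [← he ⟨(e.le_symm_apply).2 hz.1.le, (e.symm_apply_le).2 hz.2.le⟩, e.apply_symm_apply]
  rw [hasDerivAt_iff_tendsto_slope]
  have ht : Tendsto e.symm (𝓝[≠] y) (𝓝[≠] (e.symm y)) :=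
    e.symm.continuous.continuousWithinAt.tendsto_nhdsWithin
      fun z hz => e.symm.injective.ne hz
  refine (Tendsto.comp h ht).congr' ?_
  filter_upwards [mem_nhdsWithin_of_mem_nhds (Ioo_mem_nhds hy.1 hy.2)] with z hz
  simp [slope_def_field, hmem z hz, hmem y hy]

/-- Lemma 1: a Landau–Kolmogorov type inequality for γ-relative derivatives in
`L^p((a,b), λ_γ)`, with a constant `M(r,k)` independent of `p` and of the interval. -/
theorem gIter_eLpNorm_le
    (r : ℕ) (hr : 1 ≤ r) (k : ℕ) (hk : k ≤ r) :
    ∃ M : ℝ, 0 < M ∧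
      ∀ γ : ℝ → ℝ, StrictMonoOn γ (Ici 0) → ContinuousOn γ (Ici 0) →
      ∀ μ : Measure ℝ,
        (∀ c d : ℝ, 0 ≤ c → c ≤ d → μ (Ioc c d) = ENNReal.ofReal (γ d - γ c)) →
      ∀ a b : ℝ, 0 ≤ a → a < b →
      ∀ p : ℝ≥0∞, 1 ≤ p →
      ∀ f : ℝ → ℝ, GDiffOn γ f r (Ioo a b) →
        eLpNorm f p (μ.restrict (Ioo a b)) < ⊤ →
        eLpNorm (gIter γ f r) p (μ.restrict (Ioo a b)) < ⊤ →
        eLpNorm (gIter γ f k) p (μ.restrict (Ioo a b)) ≤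
          ENNReal.ofReal (M * (γ b - γ a) ^ (-(k : ℤ))) *
              eLpNorm f p (μ.restrict (Ioo a b))
            + ENNReal.ofReal (M * (γ b - γ a) ^ ((r : ℤ) - k)) *
              eLpNorm (gIter γ f r) p (μ.restrict (Ioo a b)) := by
  rcases hk.eq_or_lt with rfl | hlt
  · refine ⟨1, one_pos, ?_⟩
    intro γ _ _ μ _ a b _ _ p _ f _ _ _
    simp
  obtain ⟨d, rfl⟩ : ∃ d, r = k + d + 1 := ⟨r - k - 1, by omega⟩
  obtain ⟨M, hM, hMk⟩ := exists_eLpNorm_deriv_le k d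
  refine ⟨M, hM, ?_⟩
  intro γ hγ hc μ hμ a b ha hab p hp f hf hf0 hfr
  have hsub : Icc a b ⊆ Ici 0 := fun x hx => ha.trans hx.1
  obtain ⟨e, he⟩ := exists_orderIso_eqOn_Icc hab.le (hγ.mono hsub) (hc.mono hsub)
  have hmap := map_symm_volume_restrict_Ioo e he μ
    fun c d hac hcd _ => hμ c d (ha.trans hac) hcd
  have hemb : MeasurableEmbedding e.symm := e.symm.toHomeomorph.measurableEmbedding
  have hnorm : ∀ F : ℝ → ℝ, eLpNorm F p (μ.restrict (Ioo a b)) =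
      eLpNorm (F ∘ e.symm) p (volume.restrict (Ioo (e a) (e b))) := fun F => by
    rw [hmap, hemb.eLpNorm_map_measure]
  have key := hMk (fun j => gIter γ f j ∘ e.symm) (e a) (e b) (e.strictMono hab) p hp
    (fun j hj y hy => (hf j hj (e.symm y)
      ⟨e.lt_symm_apply.2 hy.1, e.symm_apply_lt.2 hy.2⟩).hasDerivAt_comp_symm e he hy)
    ((hnorm f).symm.trans_lt hf0) ((hnorm _).symm.trans_lt hfr)
  have hexp : ((k + d + 1 : ℕ) : ℤ) - k = ((d + 1 : ℕ) : ℤ) := by push_cast; ring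
  rw [hexp, zpow_neg, zpow_natCast, zpow_natCast, hnorm, hnorm f, hnorm (gIter γ f (k + d + 1)),
    ← he (left_mem_Icc.2 hab.le), ← he (right_mem_Icc.2 hab.le)]
  exact key
end
end

section
/- Let 0 ≤ a < b < ∞, 1 ≤ p ≤ ∞, and let r ≥ 1 be an integer. If f is r-times differentiable on (a,b) with f, f^{(r)} ∈ L^p(a,b), then for every 0 ≤ k ≤ r there is a constant M(r,k), independent of p and of the interval [a,b], such that ‖f^{(k)}‖_{L^p(a,b)} ≤ M(r,k)·( ‖f‖_{L^p(a,b)} (b−a)^{−k} + ‖f^{(r)}‖_{L^p(a,b)} (b−a)^{r−k} ). -/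
open MeasureTheory Filter Set Topology
open scoped ENNReal NNReal

noncomputable section

/-- A chain of derivatives: `F (j + 1)` is the derivative of `F j` on `(a, b)` for `j < r`. -/
def IsDerivChain (F : ℕ → ℝ → ℝ) (r : ℕ) (a b : ℝ) : Prop :=
  ∀ j < r, ∀ x ∈ Ioo a b, HasDerivAt (F j) (F (j + 1) x) x

lemma IsDerivChain.mono {F : ℕ → ℝ → ℝ} {r s : ℕ} {a b : ℝ} (h : IsDerivChain F r a b)
    (hs : s ≤ r) : IsDerivChain F s a b := fun j hj => h j (hj.trans_le hs)

/-- A function takes somewhere a value at most its mean absolute value. -/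
lemma exists_abs_le_integral_div {f : ℝ → ℝ} {a b c d : ℝ} (hac : a ≤ c) (hcd : c < d)
    (hdb : d ≤ b) (hf : IntegrableOn f (Ioo a b)) :
    ∃ x ∈ Ioo c d, |f x| ≤ (∫ t in Ioo a b, |f t|) / (d - c) := by
  by_contra! hcon
  have hsub : Ioo c d ⊆ Ioo a b := Ioo_subset_Ioo hac hdb
  have hpos : 0 < d - c := sub_pos.2 hcd
  have hle : ∫ t in Ioo c d, |f t| ≤ ∫ t in Ioo a b, |f t| :=
    setIntegral_mono_set hf.abs (ae_of_all _ fun _ => abs_nonneg _) hsub.eventuallyLE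
  have hvol : volume (Ioo c d) ≠ 0 := by simp [hcd]
  have hvol' : volume (Ioo c d) ≠ ⊤ := by simp
  obtain ⟨x, hx, hxle⟩ := exists_le_setAverage hvol hvol' (hf.mono_set hsub).abs
  have hlt := hcon x hx
  rw [setAverage_eq, smul_eq_mul, measureReal_def, Real.volume_Ioo,
    ENNReal.toReal_ofReal hpos.le, inv_mul_eq_div] at hxle
  have := div_le_div_of_nonneg_right hle hpos.le
  linarith

/-- On every subinterval of length `ℓ` the `k`-th derivative is somewhere of size at most
a multiple of `ℓ ^ (-k - 1) * ‖f‖₁`. -/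
lemma exists_abs_iterate_le (k : ℕ) :
    ∃ C : ℝ, 0 < C ∧ ∀ (F : ℕ → ℝ → ℝ) (a b : ℝ), IsDerivChain F k a b →
      IntegrableOn (F 0) (Ioo a b) → ∀ c d : ℝ, a ≤ c → c < d → d ≤ b →
      ∃ x ∈ Ioo c d, |F k x| ≤ C * ((∫ t in Ioo a b, |F 0 t|) / (d - c) ^ (k + 1)) := by
  induction k with
  | zero =>
    refine ⟨1, one_pos, fun F a b _ hF c d hac hcd hdb => ?_⟩
    simpa using exists_abs_le_integral_div hac hcd hdb hF
  | succ k ih =>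
    obtain ⟨C, hC, H⟩ := ih
    refine ⟨2 * 3 ^ (k + 2) * C, by positivity, fun F a b hch hF c d hac hcd hdb => ?_⟩
    set N := ∫ t in Ioo a b, |F 0 t|
    have hN : 0 ≤ N := integral_nonneg fun _ => abs_nonneg _
    obtain ⟨ℓ, hℓ, rfl⟩ : ∃ ℓ > 0, d = c + 3 * ℓ := ⟨(d - c) / 3, by linarith, by ring⟩
    have hch' := hch.mono k.le_succ
    obtain ⟨x, hx, hxle⟩ := H F a b hch' hF c (c + ℓ) hac (by linarith) (by linarith)
    obtain ⟨y, hy, hyle⟩ :=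
      H F a b hch' hF (c + 2 * ℓ) (c + 3 * ℓ) (by linarith) (by linarith) hdb
    rw [show c + ℓ - c = ℓ by ring] at hxle
    rw [show c + 3 * ℓ - (c + 2 * ℓ) = ℓ by ring] at hyle
    have hxy : ℓ ≤ y - x := by linarith [hx.2, hy.1]
    have hder : ∀ z ∈ Icc x y, HasDerivAt (F k) (F (k + 1) z) z := fun z hz =>
      hch k k.lt_succ_self z ⟨by linarith [hx.1, hz.1], by linarith [hy.2, hz.2]⟩
    obtain ⟨z, hz, hzeq⟩ := exists_hasDerivAt_eq_slope (F k) (F (k + 1)) (by linarith : x < y)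
      (fun z hz => (hder z hz).continuousAt.continuousWithinAt)
      (fun z hz => hder z (Ioo_subset_Icc_self hz))
    refine ⟨z, ⟨by linarith [hx.1, hz.1], by linarith [hy.2, hz.2]⟩, ?_⟩
    have hnum : |F k y - F k x| ≤ 2 * C * (N / ℓ ^ (k + 1)) := by
      linarith [abs_sub (F k y) (F k x)]
    have hbd : 0 ≤ 2 * C * (N / ℓ ^ (k + 1)) := by positivity
    rw [hzeq, abs_div, abs_of_pos (by linarith : 0 < y - x)]
    calc |F k y - F k x| / (y - x) ≤ 2 * C * (N / ℓ ^ (k + 1)) / ℓ :=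
          div_le_div₀ hbd hnum hℓ hxy
      _ = 2 * 3 ^ (k + 2) * C * (N / (c + 3 * ℓ - c) ^ (k + 1 + 1)) := by
          rw [add_sub_cancel_left, mul_pow]
          field_simp
          ring

/-- The oscillation of a differentiable function is at most the `L¹` norm of its derivative. -/
lemma abs_sub_le_integral_of_hasDerivAt_s9 {f g : ℝ → ℝ} {a b x y : ℝ}
    (hfg : ∀ z ∈ Ioo a b, HasDerivAt f (g z) z) (hg : IntegrableOn g (Ioo a b))
    (hx : x ∈ Ioo a b) (hy : y ∈ Ioo a b) : |f x - f y| ≤ ∫ t in Ioo a b, |g t| := by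
  have hsub : uIcc y x ⊆ Ioo a b := ordConnected_Ioo.uIcc_subset hy hx
  have hsub' : uIoc y x ⊆ Ioo a b := uIoc_subset_uIcc.trans hsub
  rw [← intervalIntegral.integral_eq_sub_of_hasDerivAt (fun z hz => hfg z (hsub hz))
    (intervalIntegrable_iff.2 (hg.mono_set hsub'))]
  calc |∫ t in y..x, g t| ≤ ∫ t in uIoc y x, |g t| :=
        intervalIntegral.norm_integral_le_integral_norm_uIoc (f := g)
    _ ≤ ∫ t in Ioo a b, |g t| :=
        setIntegral_mono_set hg.abs (ae_of_all _ fun _ => abs_nonneg _) hsub'.eventuallyLE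

/-- Pointwise `L¹`–`L^∞` form of the Landau–Kolmogorov inequality. -/
lemma exists_abs_le_landau (j k : ℕ) :
    ∃ M : ℝ, 0 < M ∧ ∀ (F : ℕ → ℝ → ℝ) (a b : ℝ), a < b → IsDerivChain F (k + j + 1) a b →
      IntegrableOn (F 0) (Ioo a b) → IntegrableOn (F (k + j + 1)) (Ioo a b) →
      ∀ x ∈ Ioo a b, |F k x| ≤ M * ((∫ t in Ioo a b, |F 0 t|) / (b - a) ^ (k + 1)
        + (b - a) ^ j * ∫ t in Ioo a b, |F (k + j + 1) t|) := by
  induction j generalizing k with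
  | zero =>
    obtain ⟨C, hC, H⟩ := exists_abs_iterate_le k
    refine ⟨C + 1, by positivity, fun F a b hab hch hF hG x hx => ?_⟩
    obtain ⟨y, hy, hyle⟩ := H F a b (hch.mono (by lia)) hF a b le_rfl hab le_rfl
    have hosc := abs_sub_le_integral_of_hasDerivAt_s9 (hch k (by lia)) hG hx hy
    have hpos : 0 < b - a := sub_pos.2 hab
    have hN : 0 ≤ (∫ t in Ioo a b, |F 0 t|) / (b - a) ^ (k + 1) :=
      div_nonneg (integral_nonneg fun _ => abs_nonneg _) (by positivity)
    have hI : 0 ≤ ∫ t in Ioo a b, |F (k + 1) t| := integral_nonneg fun _ => abs_nonneg _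
    simp only [add_zero, pow_zero, one_mul] at hosc ⊢
    have htri := abs_sub_abs_le_abs_sub (F k x) (F k y)
    nlinarith [mul_nonneg hC.le hI]
  | succ j ih =>
    obtain ⟨C, hC, H⟩ := exists_abs_iterate_le k
    obtain ⟨M, hM, K⟩ := ih (k + 1)
    refine ⟨C + M, by positivity, fun F a b hab hch hF hG x hx => ?_⟩
    rw [show k + (j + 1) + 1 = k + 1 + j + 1 by ring] at hch hG ⊢
    obtain ⟨y, hy, hyle⟩ := H F a b (hch.mono (by lia)) hF a b le_rfl hab le_rfl
    have hbound := K F a b hab hch hF hG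
    have hpos : 0 < b - a := sub_pos.2 hab
    set N := ∫ t in Ioo a b, |F 0 t|
    set I := ∫ t in Ioo a b, |F (k + 1 + j + 1) t|
    have hI : 0 ≤ I := integral_nonneg fun _ => abs_nonneg _
    have hosc := (convex_Ioo a b).norm_image_sub_le_of_norm_hasDerivWithin_le
      (fun z hz => (hch k (by lia) z hz).hasDerivWithinAt) hbound hy hx
    have hyx : ‖x - y‖ ≤ b - a := by
      rw [Real.norm_eq_abs, abs_le]
      constructor <;> linarith [hx.1, hx.2, hy.1, hy.2]
    have hB := (abs_nonneg _).trans (hbound x hx)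
    have hosc' := hosc.trans (mul_le_mul_of_nonneg_left hyx hB)
    have hexp : M * (N / (b - a) ^ (k + 1 + 1) + (b - a) ^ j * I) * (b - a)
        = M * (N / (b - a) ^ (k + 1) + (b - a) ^ (j + 1) * I) := by
      field_simp
      ring
    rw [hexp, Real.norm_eq_abs] at hosc'
    have htri := abs_sub_abs_le_abs_sub (F k x) (F k y)
    have : 0 ≤ C * ((b - a) ^ (j + 1) * I) := by positivity
    linarith

lemma isDerivChain_iteratedDerivWithin {f : ℝ → ℝ} {r : ℕ} {a b : ℝ}
    (hf : ∀ j < r, DifferentiableOn ℝ (iteratedDerivWithin j f (Ioo a b)) (Ioo a b)) :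
    IsDerivChain (fun j => iteratedDerivWithin j f (Ioo a b)) r a b := fun j hj x hx => by
  beta_reduce
  rw [iteratedDerivWithin_succ]
  exact (hf j hj x hx).hasDerivWithinAt.hasDerivAt (isOpen_Ioo.mem_nhds hx)

lemma IsDerivChain.aestronglyMeasurable {F : ℕ → ℝ → ℝ} {r k : ℕ} {a b : ℝ}
    (h : IsDerivChain F r a b) (hr : 1 ≤ r) (hk : k ≤ r) :
    AEStronglyMeasurable (F k) (volume.restrict (Ioo a b)) := by
  rcases k with _ | k
  · exact ContinuousOn.aestronglyMeasurable
      (fun x hx => (h 0 hr x hx).continuousAt.continuousWithinAt) measurableSet_Ioo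
  · refine (aestronglyMeasurable_deriv (F k) _).congr ?_
    filter_upwards [ae_restrict_mem measurableSet_Ioo] with x hx
    exact (h k hk x hx).deriv

/-- An `L¹`–`L^∞` bound on a finite measure space implies the corresponding `L^p` bound. -/
lemma eLpNorm_le_of_abs_le_integral {α : Type*} [MeasurableSpace α] {μ : Measure α}
    [IsFiniteMeasure μ] {f g u : α → ℝ} {p : ℝ≥0∞} (hp : 1 ≤ p) {A B : ℝ} (hA : 0 ≤ A)
    (hB : 0 ≤ B) (hf : MemLp f p μ) (hg : MemLp g p μ)
    (hu : ∀ᵐ x ∂μ, |u x| ≤ A * (∫ t, |f t| ∂μ) + B * ∫ t, |g t| ∂μ) :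
    eLpNorm u p μ ≤ μ univ * ENNReal.ofReal A * eLpNorm f p μ
      + μ univ * ENNReal.ofReal B * eLpNorm g p μ := by
  by_cases hμ : μ = 0
  · simp [hμ]
  have hv0 : μ univ ≠ 0 := by simpa using hμ
  have hv : μ univ ≠ ⊤ := measure_ne_top _ _
  have key : ∀ w : α → ℝ, MemLp w p μ →
      μ univ ^ p.toReal⁻¹ * ENNReal.ofReal (∫ t, |w t| ∂μ) ≤ μ univ * eLpNorm w p μ := by
    intro w hw
    have h1 : ENNReal.ofReal (∫ t, |w t| ∂μ) = eLpNorm w 1 μ := by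
      rw [eLpNorm_one_eq_lintegral_enorm]
      exact ofReal_integral_norm_eq_lintegral_enorm (hw.integrable hp)
    have h2 := eLpNorm_le_eLpNorm_mul_rpow_measure_univ hp hw.1
    rw [h1]
    calc _ ≤ μ univ ^ p.toReal⁻¹ *
          (eLpNorm w p μ * μ univ ^ (1 / (1 : ℝ≥0∞).toReal - 1 / p.toReal)) := by gcongr
      _ = μ univ ^ (p.toReal⁻¹ + (1 / (1 : ℝ≥0∞).toReal - 1 / p.toReal)) * eLpNorm w p μ := by
          rw [ENNReal.rpow_add _ _ hv0 hv]; ring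
      _ = μ univ * eLpNorm w p μ := by simp
  have hIf : 0 ≤ ∫ t, |f t| ∂μ := integral_nonneg fun _ => abs_nonneg _
  have hIg : 0 ≤ ∫ t, |g t| ∂μ := integral_nonneg fun _ => abs_nonneg _
  refine (eLpNorm_le_of_ae_bound hu).trans ?_
  rw [ENNReal.ofReal_add (by positivity) (by positivity), ENNReal.ofReal_mul hA,
    ENNReal.ofReal_mul hB]
  calc _ = ENNReal.ofReal A * (μ univ ^ p.toReal⁻¹ * ENNReal.ofReal (∫ t, |f t| ∂μ))
        + ENNReal.ofReal B * (μ univ ^ p.toReal⁻¹ * ENNReal.ofReal (∫ t, |g t| ∂μ)) := by ring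
    _ ≤ ENNReal.ofReal A * (μ univ * eLpNorm f p μ)
        + ENNReal.ofReal B * (μ univ * eLpNorm g p μ) := by
        exact add_le_add (mul_le_mul_right (key f hf) _) (mul_le_mul_right (key g hg) _)
    _ = _ := by ring

/-- Lemma 3 (Ditzian): a Landau–Kolmogorov type inequality for classical derivatives in
`L^p(a,b)`, with a constant `M(r,k)` independent of `p` and of the interval. -/
theorem iteratedDeriv_eLpNorm_le
    (r : ℕ) (hr : 1 ≤ r) (k : ℕ) (hk : k ≤ r) :
    ∃ M : ℝ, 0 < M ∧
      ∀ a b : ℝ, 0 ≤ a → a < b →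
      ∀ p : ℝ≥0∞, 1 ≤ p →
      ∀ f : ℝ → ℝ,
        (∀ j < r, DifferentiableOn ℝ (iteratedDerivWithin j f (Ioo a b)) (Ioo a b)) →
        eLpNorm f p (volume.restrict (Ioo a b)) < ⊤ →
        eLpNorm (iteratedDerivWithin r f (Ioo a b)) p (volume.restrict (Ioo a b)) < ⊤ →
        eLpNorm (iteratedDerivWithin k f (Ioo a b)) p (volume.restrict (Ioo a b)) ≤
          ENNReal.ofReal (M * ((b - a) ^ (-(k : ℤ)))) *
              eLpNorm f p (volume.restrict (Ioo a b))
            + ENNReal.ofReal (M * ((b - a) ^ ((r : ℤ) - k))) *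
              eLpNorm (iteratedDerivWithin r f (Ioo a b)) p (volume.restrict (Ioo a b)) := by
  rcases hk.eq_or_lt with rfl | hkr
  · refine ⟨1, one_pos, fun a b _ _ p _ f _ _ _ => ?_⟩
    simp
  obtain ⟨j, rfl⟩ : ∃ j, r = k + j + 1 := ⟨r - k - 1, by lia⟩
  obtain ⟨M, hM, H⟩ := exists_abs_le_landau j k
  refine ⟨M, hM, fun a b _ hab p hp f hf hfp hrp => ?_⟩
  have hch := isDerivChain_iteratedDerivWithin hf
  have hpos : 0 < b - a := sub_pos.2 hab
  have hF : MemLp f p (volume.restrict (Ioo a b)) :=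
    ⟨by simpa using hch.aestronglyMeasurable hr (Nat.zero_le _), hfp⟩
  have hG : MemLp (iteratedDerivWithin (k + j + 1) f (Ioo a b)) p (volume.restrict (Ioo a b)) :=
    ⟨hch.aestronglyMeasurable hr le_rfl, hrp⟩
  have hpt := H _ a b hab hch (by simpa [IntegrableOn] using hF.integrable hp) (hG.integrable hp)
  have hmain := eLpNorm_le_of_abs_le_integral (u := iteratedDerivWithin k f (Ioo a b)) hp
    (A := M / (b - a) ^ (k + 1)) (B := M * (b - a) ^ j) (by positivity) (by positivity) hF hG (by
      filter_upwards [ae_restrict_mem measurableSet_Ioo] with x hx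
      refine (hpt x hx).trans_eq ?_
      simp only [iteratedDerivWithin_zero]
      ring)
  rw [Measure.restrict_apply_univ, Real.volume_Ioo, ← ENNReal.ofReal_mul hpos.le,
    ← ENNReal.ofReal_mul hpos.le] at hmain
  convert hmain using 4
  · rw [zpow_neg, zpow_natCast]
    field_simp
    ring
  · rw [show ((k + j + 1 : ℕ) : ℤ) - k = ((j + 1 : ℕ) : ℤ) by push_cast; ring, zpow_natCast]
    ring
end
end

section
/- Let γ be a strictly increasing continuous function on a neighborhood of x₀, and let n ≥ 1. If f and g are n-times γ-relative differentiable on a neighborhood of x₀, then f·g is n-times γ-relative differentiable at x₀ and (fg)_γ^{(n)}(x₀) = Σ_{k=0}^{n} (n choose k) f_γ^{(k)}(x₀) · g_γ^{(n−k)}(x₀). -/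
open MeasureTheory Filter Set Topology
open scoped ENNReal NNReal

noncomputable section

/-- Near a point around which `γ` is strictly monotone, `γ` is injective at that point. -/
theorem eventually_sub_ne_zero_of_strictMonoOn {γ : ℝ → ℝ} {u : Set ℝ} {x : ℝ} (hu : u ∈ 𝓝 x)
    (hγ : StrictMonoOn γ u) : ∀ᶠ y in 𝓝[≠] x, γ y - γ x ≠ 0 := by
  filter_upwards [self_mem_nhdsWithin, mem_nhdsWithin_of_mem_nhds hu] with y hy hyu h
  exact hy (hγ.injOn hyu (mem_of_mem_nhds hu) (sub_eq_zero.1 h))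

theorem HasGDerivAt.gDeriv_eq {γ f : ℝ → ℝ} {L x : ℝ} (h : HasGDerivAt γ f L x) :
    gDeriv γ f x = L :=
  h.limUnder_eq

theorem HasGDerivAt.congr_of_eventuallyEq {γ f g : ℝ → ℝ} {L x : ℝ} (h : HasGDerivAt γ f L x)
    (hfg : g =ᶠ[𝓝 x] f) : HasGDerivAt γ g L x := by
  refine Tendsto.congr' ?_ h
  filter_upwards [hfg.filter_mono nhdsWithin_le_nhds] with y hy
  rw [hy, hfg.eq_of_nhds]

theorem HasGDerivAt.const_mul {γ f : ℝ → ℝ} {L x : ℝ} (c : ℝ) (h : HasGDerivAt γ f L x) :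
    HasGDerivAt γ (fun y => c * f y) (c * L) x := by
  refine (Tendsto.const_mul c h).congr fun y => ?_
  ring

theorem HasGDerivAt.sum {ι : Type*} {γ : ℝ → ℝ} {f : ι → ℝ → ℝ} {L : ι → ℝ} {x : ℝ}
    (s : Finset ι) (h : ∀ i ∈ s, HasGDerivAt γ (f i) (L i) x) :
    HasGDerivAt γ (fun y => ∑ i ∈ s, f i y) (∑ i ∈ s, L i) x := by
  refine (tendsto_finsetSum s h).congr fun y => ?_
  rw [← Finset.sum_sub_distrib, Finset.sum_div]

theorem HasGDerivAt.tendsto {γ f : ℝ → ℝ} {L x : ℝ} (h : HasGDerivAt γ f L x)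
    (hγc : ContinuousAt γ x) (hγ : ∀ᶠ y in 𝓝[≠] x, γ y - γ x ≠ 0) :
    Tendsto f (𝓝[≠] x) (𝓝 (f x)) := by
  have hγ0 : Tendsto (fun y => γ y - γ x) (𝓝[≠] x) (𝓝 0) := by
    simpa using (hγc.tendsto.mono_left nhdsWithin_le_nhds).sub_const (γ x)
  have h0 := (Tendsto.mul h hγ0).add_const (f x)
  rw [mul_zero, zero_add] at h0
  refine h0.congr' ?_
  filter_upwards [hγ] with y hy
  rw [div_mul_cancel₀ _ hy, sub_add_cancel]

theorem HasGDerivAt.mul {γ f g : ℝ → ℝ} {L M x : ℝ} (hf : HasGDerivAt γ f L x)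
    (hg : HasGDerivAt γ g M x) (hγc : ContinuousAt γ x)
    (hγ : ∀ᶠ y in 𝓝[≠] x, γ y - γ x ≠ 0) :
    HasGDerivAt γ (fun y => f y * g y) (f x * M + L * g x) x := by
  refine (((hf.tendsto hγc hγ).mul hg).add (Tendsto.mul_const (g x) hf)).congr fun y => ?_
  ring

/-- The right-hand side of the `m`-th order Leibniz rule at `x`. -/
def leibnizSum (γ f g : ℝ → ℝ) (m : ℕ) (x : ℝ) : ℝ :=
  ∑ ij ∈ Finset.HasAntidiagonal.antidiagonal m,
    (m.choose ij.1 : ℝ) * (gIter γ f ij.1 x * gIter γ g ij.2 x)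

theorem leibnizSum_succ (γ f g : ℝ → ℝ) (m : ℕ) (x : ℝ) :
    leibnizSum γ f g (m + 1) x =
      ∑ ij ∈ Finset.HasAntidiagonal.antidiagonal m, (m.choose ij.1 : ℝ) *
        (gIter γ f ij.1 x * gIter γ g (ij.2 + 1) x +
          gIter γ f (ij.1 + 1) x * gIter γ g ij.2 x) := by
  rw [leibnizSum, Finset.sum_antidiagonal_choose_succ_mul
    (fun i j => gIter γ f i x * gIter γ g j x), ← Finset.sum_add_distrib]
  refine Finset.sum_congr rfl fun ij hij => ?_
  rw [Nat.choose_symm_of_eq_add (Finset.HasAntidiagonal.mem_antidiagonal.1 hij).symm, mul_add]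

theorem hasGDerivAt_leibnizSum {γ f g : ℝ → ℝ} {n m : ℕ} {u : Set ℝ} {x : ℝ} (hu : u ∈ 𝓝 x)
    (hγm : StrictMonoOn γ u) (hγc : ContinuousOn γ u) (hf : GDiffOn γ f n u)
    (hg : GDiffOn γ g n u) (hm : m < n) :
    HasGDerivAt γ (leibnizSum γ f g m) (leibnizSum γ f g (m + 1) x) x := by
  rw [leibnizSum_succ]
  refine HasGDerivAt.sum _ fun ij hij => ?_
  have hij := Finset.HasAntidiagonal.mem_antidiagonal.1 hij
  have hx := mem_of_mem_nhds hu
  exact ((hf ij.1 (by lia) x hx).mul (hg ij.2 (by lia) x hx) (hγc.continuousAt hu)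
    (eventually_sub_ne_zero_of_strictMonoOn hu hγm)).const_mul _

theorem gIter_mul_eq_leibnizSum {γ f g : ℝ → ℝ} {n m : ℕ} {u : Set ℝ} {x : ℝ} (hu : u ∈ 𝓝 x)
    (hγm : StrictMonoOn γ u) (hγc : ContinuousOn γ u) (hf : GDiffOn γ f n u)
    (hg : GDiffOn γ g n u) (hm : m ≤ n) :
    gIter γ (fun y => f y * g y) m x = leibnizSum γ f g m x := by
  induction m generalizing x with
  | zero => simp [leibnizSum, gIter]
  | succ m ih =>
    refine ((hasGDerivAt_leibnizSum hu hγm hγc hf hg hm).congr_of_eventuallyEq ?_).gDeriv_eq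
    filter_upwards [eventually_mem_nhds_iff.2 hu] with y hy using ih hy (by lia)

/-- Statement 1 (generalized Leibniz rule): if `f` and `g` are `n`-times γ-relative
differentiable on a neighborhood of `x₀`, then so is `f·g` at `x₀`, and
`(fg)_γ^{(n)}(x₀) = Σ_{k=0}^n (n choose k) f_γ^{(k)}(x₀) g_γ^{(n-k)}(x₀)`. -/
theorem gIter_mul
    (γ f g : ℝ → ℝ) (x₀ : ℝ) (n : ℕ) (hn : 1 ≤ n) (u : Set ℝ) (hu : u ∈ 𝓝 x₀)
    (hγm : StrictMonoOn γ u) (hγc : ContinuousOn γ u)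
    (hf : GDiffOn γ f n u) (hg : GDiffOn γ g n u) :
    GDiffOn γ (fun x => f x * g x) n {x₀} ∧
      gIter γ (fun x => f x * g x) n x₀ =
        ∑ k ∈ Finset.range (n + 1),
          (n.choose k : ℝ) * gIter γ f k x₀ * gIter γ g (n - k) x₀ := by
  have hD : ∀ m ≤ n, ∀ᶠ x in 𝓝 x₀,
      gIter γ (fun x => f x * g x) m x = leibnizSum γ f g m x := fun m hm => by
    filter_upwards [eventually_mem_nhds_iff.2 hu] with x hx
    exact gIter_mul_eq_leibnizSum hx hγm hγc hf hg hm
  refine ⟨fun k hk x hx => ?_, ?_⟩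
  · obtain rfl : x = x₀ := hx
    rw [(hD (k + 1) hk).self_of_nhds]
    exact (hasGDerivAt_leibnizSum hu hγm hγc hf hg hk).congr_of_eventuallyEq (hD k hk.le)
  · rw [(hD n le_rfl).self_of_nhds, leibnizSum, Finset.Nat.sum_antidiagonal_eq_sum_range_succ
      (fun i j => (n.choose i : ℝ) * (gIter γ f i x₀ * gIter γ g j x₀))]
    simp only [mul_assoc]
end
end

section
/- Let γ be a continuous strictly increasing function on an interval I, and let r ≥ 1 be an integer. Then f : I → ℝ is r-times γ-relative differentiable on I if and only if f ∘ γ⁻¹ is r-times differentiable on γ(I) in the classical sense; in that case, for every y ∈ γ(I), (f_γ^{(r)} ∘ γ⁻¹)(y) = (f ∘ γ⁻¹)^{(r)}(y). -/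
open MeasureTheory Filter Set Topology
open scoped ENNReal NNReal

noncomputable section

theorem image_mem_nhds_of_strictMonoOn_Ioo {γ : ℝ → ℝ} {c d x : ℝ}
    (hγm : StrictMonoOn γ (Ioo c d)) (hγc : ContinuousOn γ (Ioo c d)) (hx : x ∈ Ioo c d) :
    γ '' Ioo c d ∈ 𝓝 (γ x) := by
  obtain ⟨a, hca, hax⟩ := exists_between hx.1
  obtain ⟨b, hxb, hbd⟩ := exists_between hx.2
  have ha : a ∈ Ioo c d := ⟨hca, hax.trans hx.2⟩
  have hb : b ∈ Ioo c d := ⟨hx.1.trans hxb, hbd⟩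
  have hsub : Icc a b ⊆ Ioo c d := Icc_subset_Ioo hca hbd
  exact mem_of_superset (Icc_mem_nhds (hγm ha hx hax) (hγm hx hb hxb))
    ((intermediate_value_Icc (hax.trans hxb).le (hγc.mono hsub)).trans (image_mono hsub))

theorem continuousAt_invFunOn_Ioo {γ : ℝ → ℝ} {c d x : ℝ}
    (hγm : StrictMonoOn γ (Ioo c d)) (hγc : ContinuousOn γ (Ioo c d)) (hx : x ∈ Ioo c d) :
    ContinuousAt (Function.invFunOn γ (Ioo c d)) (γ x) := by
  have hleft : LeftInvOn (Function.invFunOn γ (Ioo c d)) γ (Ioo c d) :=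
    hγm.injOn.leftInvOn_invFunOn
  have hmono : StrictMonoOn (Function.invFunOn γ (Ioo c d)) (γ '' Ioo c d) := by
    rintro _ ⟨u, hu, rfl⟩ _ ⟨v, hv, rfl⟩ huv
    rw [hleft hu, hleft hv]
    exact (hγm.lt_iff_lt hu hv).1 huv
  refine hmono.continuousAt_of_image_mem_nhds
    (image_mem_nhds_of_strictMonoOn_Ioo hγm hγc hx) ?_
  rw [hleft.image_image, hleft hx]
  exact Ioo_mem_nhds hx.1 hx.2

theorem map_nhdsNE_of_strictMonoOn_Ioo {γ : ℝ → ℝ} {c d x : ℝ}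
    (hγm : StrictMonoOn γ (Ioo c d)) (hγc : ContinuousOn γ (Ioo c d)) (hx : x ∈ Ioo c d) :
    map γ (𝓝[≠] x) = 𝓝[≠] (γ x) := by
  have hU : Ioo c d ∈ 𝓝 x := Ioo_mem_nhds hx.1 hx.2
  have hV := image_mem_nhds_of_strictMonoOn_Ioo hγm hγc hx
  have hleft : LeftInvOn (Function.invFunOn γ (Ioo c d)) γ (Ioo c d) :=
    hγm.injOn.leftInvOn_invFunOn
  refine le_antisymm (tendsto_nhdsWithin_iff.2
    ⟨(hγc.continuousAt hU).tendsto.mono_left nhdsWithin_le_nhds, ?_⟩) ?_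
  · filter_upwards [mem_nhdsWithin_of_mem_nhds hU, self_mem_nhdsWithin] with u hu hux h
    exact hux (hγm.injOn hu hx h)
  · have hinv : Tendsto (Function.invFunOn γ (Ioo c d)) (𝓝[≠] (γ x)) (𝓝[≠] x) := by
      refine tendsto_nhdsWithin_iff.2 ⟨?_, ?_⟩
      · simpa only [ContinuousAt, hleft hx] using
          (continuousAt_invFunOn_Ioo hγm hγc hx).tendsto.mono_left
            (nhdsWithin_le_nhds (s := {γ x}ᶜ))
      · filter_upwards [mem_nhdsWithin_of_mem_nhds hV, self_mem_nhdsWithin]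
        rintro _ ⟨u, hu, rfl⟩ hux h
        rw [mem_singleton_iff, hleft hu] at h
        exact hux (congrArg γ h)
    calc 𝓝[≠] (γ x) = map (γ ∘ Function.invFunOn γ (Ioo c d)) (𝓝[≠] (γ x)) := by
          conv_lhs => rw [← map_id (f := 𝓝[≠] (γ x))]
          refine Filter.map_congr ?_
          filter_upwards [mem_nhdsWithin_of_mem_nhds hV] with y hy
          exact (Function.invFunOn_eq hy).symm
      _ ≤ map γ (𝓝[≠] x) := by
          rw [← map_map]
          exact map_mono hinv

theorem hasGDerivAt_iff_hasDerivAt_comp_invFunOn {γ : ℝ → ℝ} {c d x : ℝ}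
    (hγm : StrictMonoOn γ (Ioo c d)) (hγc : ContinuousOn γ (Ioo c d)) (hx : x ∈ Ioo c d)
    (f : ℝ → ℝ) (L : ℝ) :
    HasGDerivAt γ f L x ↔ HasDerivAt (f ∘ Function.invFunOn γ (Ioo c d)) L (γ x) := by
  have hleft : LeftInvOn (Function.invFunOn γ (Ioo c d)) γ (Ioo c d) :=
    hγm.injOn.leftInvOn_invFunOn
  rw [hasDerivAt_iff_tendsto_slope, ← map_nhdsNE_of_strictMonoOn_Ioo hγm hγc hx,
    tendsto_map'_iff, HasGDerivAt]
  refine tendsto_congr' ?_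
  filter_upwards [mem_nhdsWithin_of_mem_nhds (Ioo_mem_nhds hx.1 hx.2)] with u hu
  simp [slope_def_field, hleft hu, hleft hx]

theorem HasGDerivAt.hasGDerivAt_gDeriv {γ f : ℝ → ℝ} {L x : ℝ} (h : HasGDerivAt γ f L x) :
    HasGDerivAt γ f (gDeriv γ f x) x :=
  tendsto_nhds_limUnder ⟨L, h⟩

theorem differentiableOn_comp_invFunOn_iff {γ : ℝ → ℝ} {c d : ℝ}
    (hγm : StrictMonoOn γ (Ioo c d)) (hγc : ContinuousOn γ (Ioo c d)) (f : ℝ → ℝ) :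
    DifferentiableOn ℝ (f ∘ Function.invFunOn γ (Ioo c d)) (γ '' Ioo c d) ↔
      ∀ x ∈ Ioo c d, HasGDerivAt γ f (gDeriv γ f x) x := by
  refine ⟨fun h x hx => ?_, ?_⟩
  · have hd := (h (γ x) (mem_image_of_mem γ hx)).differentiableAt
      (image_mem_nhds_of_strictMonoOn_Ioo hγm hγc hx)
    exact ((hasGDerivAt_iff_hasDerivAt_comp_invFunOn hγm hγc hx f _).2
      hd.hasDerivAt).hasGDerivAt_gDeriv
  · rintro h _ ⟨x, hx, rfl⟩
    exact ((hasGDerivAt_iff_hasDerivAt_comp_invFunOn hγm hγc hx f _).1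
      (h x hx)).differentiableAt.differentiableWithinAt

theorem gDiffOn_succ {γ f : ℝ → ℝ} {n : ℕ} {s : Set ℝ} :
    GDiffOn γ f (n + 1) s ↔
      GDiffOn γ f n s ∧ ∀ x ∈ s, HasGDerivAt γ (gIter γ f n) (gIter γ f (n + 1) x) x :=
  Nat.forall_lt_succ_right

theorem GDiffOn.eqOn_iteratedDerivWithin {γ f : ℝ → ℝ} {c d : ℝ} {n : ℕ}
    (hγm : StrictMonoOn γ (Ioo c d)) (hγc : ContinuousOn γ (Ioo c d))
    (h : GDiffOn γ f n (Ioo c d)) :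
    EqOn (iteratedDerivWithin n (f ∘ Function.invFunOn γ (Ioo c d)) (γ '' Ioo c d))
      (gIter γ f n ∘ Function.invFunOn γ (Ioo c d)) (γ '' Ioo c d) := by
  induction n with
  | zero => simp [iteratedDerivWithin_zero, gIter, EqOn]
  | succ n ih =>
    obtain ⟨hn, hlast⟩ := gDiffOn_succ.1 h
    rintro _ ⟨x, hx, rfl⟩
    rw [iteratedDerivWithin_succ, derivWithin_congr (ih hn) (ih hn (mem_image_of_mem γ hx)),
      derivWithin_of_mem_nhds (image_mem_nhds_of_strictMonoOn_Ioo hγm hγc hx),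
      ((hasGDerivAt_iff_hasDerivAt_comp_invFunOn hγm hγc hx _ _).1 (hlast x hx)).deriv,
      Function.comp_apply, hγm.injOn.leftInvOn_invFunOn hx]

theorem gDiffOn_iff_differentiableOn_iteratedDerivWithin {γ : ℝ → ℝ} {c d : ℝ}
    (hγm : StrictMonoOn γ (Ioo c d)) (hγc : ContinuousOn γ (Ioo c d)) (f : ℝ → ℝ) (n : ℕ) :
    GDiffOn γ f n (Ioo c d) ↔
      ∀ k < n, DifferentiableOn ℝ
        (iteratedDerivWithin k (f ∘ Function.invFunOn γ (Ioo c d)) (γ '' Ioo c d))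
        (γ '' Ioo c d) := by
  induction n with
  | zero => simp [GDiffOn]
  | succ n ih =>
    rw [gDiffOn_succ, Nat.forall_lt_succ_right, ← ih]
    refine and_congr_right fun hn => ?_
    rw [differentiableOn_congr (hn.eqOn_iteratedDerivWithin hγm hγc),
      differentiableOn_comp_invFunOn_iff hγm hγc]
    rfl

/-- Statement 3: `f` is `r`-times γ-relative differentiable on `I` iff `f ∘ γ⁻¹` is
`r`-times differentiable on `γ(I)`, and then `f_γ^{(r)} ∘ γ⁻¹ = (f ∘ γ⁻¹)^{(r)}` on
`γ(I)`. -/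
theorem gIter_comp_invFun
    (γ : ℝ → ℝ) (c d : ℝ) (hγm : StrictMonoOn γ (Ioo c d))
    (hγc : ContinuousOn γ (Ioo c d)) (f : ℝ → ℝ) (r : ℕ) (hr : 1 ≤ r) :
    (GDiffOn γ f r (Ioo c d) ↔
      ∀ k < r, DifferentiableOn ℝ
        (iteratedDerivWithin k (f ∘ Function.invFunOn γ (Ioo c d)) (γ '' Ioo c d))
        (γ '' Ioo c d)) ∧
    (GDiffOn γ f r (Ioo c d) →
      ∀ y ∈ γ '' Ioo c d,
        gIter γ f r (Function.invFunOn γ (Ioo c d) y) =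
          iteratedDerivWithin r (f ∘ Function.invFunOn γ (Ioo c d)) (γ '' Ioo c d) y) :=
  ⟨gDiffOn_iff_differentiableOn_iteratedDerivWithin hγm hγc f r,
    fun h _ hy => (h.eqOn_iteratedDerivWithin hγm hγc hy).symm⟩
end
end

section
/- Let γ be a continuous strictly increasing function on a neighborhood of x₀, and suppose f is (n+1)-times γ-relative differentiable on a neighborhood of x₀. Then there exists a neighborhood K of x₀ such that for every x ∈ K there exists ξ ∈ K between x₀ and x with f(x) = Σ_{k=0}^{n} (f_γ^{(k)}(x₀)/k!) (γ(x) − γ(x₀))^k + (f_γ^{(n+1)}(ξ)/(n+1)!) (γ(x) − γ(x₀))^{n+1}. -/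
open MeasureTheory Filter Set Topology
open scoped ENNReal NNReal

noncomputable section

theorem HasGDerivAt.continuousAt {γ f : ℝ → ℝ} {L x : ℝ} (h : HasGDerivAt γ f L x)
    (hγ : ContinuousAt γ x) (hne : ∀ᶠ t in 𝓝[≠] x, γ t ≠ γ x) : ContinuousAt f x := by
  rw [continuousAt_iff_punctured_nhds]
  have hγ' : Tendsto (fun t => γ t - γ x) (𝓝[≠] x) (𝓝 0) := by
    simpa using (hγ.tendsto.mono_left nhdsWithin_le_nhds).sub_const (γ x)
  have key : Tendsto (fun t => (f t - f x) / (γ t - γ x) * (γ t - γ x) + f x)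
      (𝓝[≠] x) (𝓝 (f x)) := by
    simpa using (Tendsto.mul h hγ').add_const (f x)
  refine key.congr' ?_
  filter_upwards [hne] with t ht
  rw [div_mul_cancel₀ _ (sub_ne_zero.2 ht), sub_add_cancel]

theorem HasGDerivAt.sub {γ f g : ℝ → ℝ} {L M x : ℝ} (hf : HasGDerivAt γ f L x)
    (hg : HasGDerivAt γ g M x) : HasGDerivAt γ (fun t => f t - g t) (L - M) x :=
  (Tendsto.sub hf hg).congr fun t => by ring

theorem HasGDerivAt.neg {γ f : ℝ → ℝ} {L x : ℝ} (hf : HasGDerivAt γ f L x) :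
    HasGDerivAt γ (fun t => -f t) (-L) x :=
  (Tendsto.neg hf).congr fun t => by ring

theorem HasDerivAt.hasGDerivAt_comp {γ q : ℝ → ℝ} {L x : ℝ} (hq : HasDerivAt q L (γ x))
    (hγ : ContinuousAt γ x) (hne : ∀ᶠ t in 𝓝[≠] x, γ t ≠ γ x) :
    HasGDerivAt γ (fun t => q (γ t)) L x := by
  have hγ' : Tendsto γ (𝓝[≠] x) (𝓝[≠] (γ x)) :=
    tendsto_nhdsWithin_iff.2 ⟨hγ.tendsto.mono_left nhdsWithin_le_nhds, hne⟩
  exact (hq.tendsto_slope.comp hγ').congr fun t => by simp [slope_def_field]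

theorem IsLocalMin.hasGDerivAt_eq_zero {γ f : ℝ → ℝ} {L x : ℝ} {s : Set ℝ} (h : IsLocalMin f x)
    (hs : s ∈ 𝓝 x) (hγ : StrictMonoOn γ s) (hf : HasGDerivAt γ f L x) : L = 0 := by
  have hx : x ∈ s := mem_of_mem_nhds hs
  apply le_antisymm
  · refine le_of_tendsto (Tendsto.mono_left hf
      (nhdsWithin_mono x fun t (ht : t ∈ Iio x) => ne_of_lt ht)) ?_
    filter_upwards [nhdsWithin_le_nhds hs, nhdsWithin_le_nhds h, self_mem_nhdsWithin]
      with t hts hmin (htx : t < x)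
    exact div_nonpos_of_nonneg_of_nonpos (sub_nonneg.2 hmin)
      (sub_nonpos.2 (hγ hts hx htx).le)
  · refine ge_of_tendsto (Tendsto.mono_left hf
      (nhdsWithin_mono x fun t (ht : t ∈ Ioi x) => ne_of_gt ht)) ?_
    filter_upwards [nhdsWithin_le_nhds hs, nhdsWithin_le_nhds h, self_mem_nhdsWithin]
      with t hts hmin (htx : x < t)
    exact div_nonneg (sub_nonneg.2 hmin) (sub_nonneg.2 (hγ hx hts htx).le)

theorem IsLocalExtr.hasGDerivAt_eq_zero {γ f : ℝ → ℝ} {L x : ℝ} {s : Set ℝ}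
    (h : IsLocalExtr f x) (hs : s ∈ 𝓝 x) (hγ : StrictMonoOn γ s) (hf : HasGDerivAt γ f L x) :
    L = 0 := by
  rcases h with h | h
  · exact IsLocalMin.hasGDerivAt_eq_zero h hs hγ hf
  · exact neg_eq_zero.1 (IsLocalMin.hasGDerivAt_eq_zero (IsLocalMax.neg h) hs hγ hf.neg)

theorem StrictMonoOn.eventually_apply_ne {γ : ℝ → ℝ} {s : Set ℝ} {x : ℝ}
    (hγ : StrictMonoOn γ s) (hs : s ∈ 𝓝 x) : ∀ᶠ t in 𝓝[≠] x, γ t ≠ γ x := by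
  filter_upwards [nhdsWithin_le_nhds hs, self_mem_nhdsWithin] with t hts htx
  exact hγ.injOn.ne hts (mem_of_mem_nhds hs) htx

/-- Rolle's theorem for the γ-relative derivative. -/
theorem exists_hasGDerivAt_eq_zero {γ f f' : ℝ → ℝ} {s : Set ℝ} (hs : IsOpen s)
    (hsc : s.OrdConnected) (hγm : StrictMonoOn γ s) (hγc : ContinuousOn γ s)
    (hf : ∀ t ∈ s, HasGDerivAt γ f (f' t) t) {a b : ℝ} (ha : a ∈ s) (hb : b ∈ s)
    (hab : a < b) (hfab : f a = f b) : ∃ c ∈ Ioo a b, f' c = 0 := by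
  have hsub : Icc a b ⊆ s := hsc.out ha hb
  have hc : ContinuousOn f (Icc a b) := fun t ht =>
    have hts := hs.mem_nhds (hsub ht)
    ((hf t (hsub ht)).continuousAt (hγc.continuousAt hts)
      (hγm.eventually_apply_ne hts)).continuousWithinAt
  obtain ⟨c, hc, hext⟩ := exists_isLocalExtr_Ioo hab hc hfab
  have hcs := hsub (Ioo_subset_Icc_self hc)
  exact ⟨c, hc, hext.hasGDerivAt_eq_zero (hs.mem_nhds hcs) hγm (hf c hcs)⟩

theorem hasDerivAt_sum_div_factorial_mul_sub_pow (a : ℕ → ℝ) (n : ℕ) (y₀ y : ℝ) :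
    HasDerivAt (fun y => ∑ k ∈ Finset.range (n + 1), a k / (k.factorial : ℝ) * (y - y₀) ^ k)
      (∑ k ∈ Finset.range n, a (k + 1) / (k.factorial : ℝ) * (y - y₀) ^ k) y := by
  simp only [Finset.sum_range_succ' _ n, pow_zero, mul_one]
  refine (HasDerivAt.fun_sum fun k _ => ?_).add_const _
  refine ((((hasDerivAt_id y).sub_const y₀).pow (k + 1)).const_mul _).congr_deriv ?_
  have : (k.factorial : ℝ) ≠ 0 := by positivity
  simp only [id, Nat.factorial_succ, add_tsub_cancel_right]
  push_cast
  field_simp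

/-- Taylor's formula with Lagrange remainder for a chain `D` of γ-relative derivatives. -/
theorem gamma_taylor_lagrange_of_chain {γ : ℝ → ℝ} {s : Set ℝ} (hs : IsOpen s)
    (hsc : s.OrdConnected) (hγm : StrictMonoOn γ s) (hγc : ContinuousOn γ s) {x₀ : ℝ}
    (hx₀ : x₀ ∈ s) (n : ℕ) (D : ℕ → ℝ → ℝ)
    (hD : ∀ k < n, ∀ t ∈ s, HasGDerivAt γ (D k) (D (k + 1) t) t) {x : ℝ} (hx : x ∈ s) :
    ∃ ξ ∈ uIcc x₀ x, D 0 x =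
      (∑ k ∈ Finset.range n, D k x₀ / (k.factorial : ℝ) * (γ x - γ x₀) ^ k)
        + D n ξ / (n.factorial : ℝ) * (γ x - γ x₀) ^ n := by
  induction n generalizing D x with
  | zero => exact ⟨x, right_mem_uIcc, by simp⟩
  | succ n ih =>
    rcases eq_or_ne x x₀ with rfl | hne
    · exact ⟨x, left_mem_uIcc, by simp [Finset.sum_range_succ']⟩
    set T : ℝ → ℝ := fun y =>
      ∑ k ∈ Finset.range (n + 1), D k x₀ / (k.factorial : ℝ) * (y - γ x₀) ^ k with hT
    set T' : ℝ → ℝ := fun y =>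
      ∑ k ∈ Finset.range n, D (k + 1) x₀ / (k.factorial : ℝ) * (y - γ x₀) ^ k with hT'
    have hG : γ x - γ x₀ ≠ 0 := sub_ne_zero.2 (hγm.injOn.ne hx hx₀ hne)
    obtain ⟨M, hM⟩ : ∃ M, D 0 x = T (γ x) + M * (γ x - γ x₀) ^ (n + 1) :=
      ⟨(D 0 x - T (γ x)) / (γ x - γ x₀) ^ (n + 1), by field_simp; ring⟩
    have hq : ∀ y, HasDerivAt (fun y => T y + M * (y - γ x₀) ^ (n + 1))
        (T' y + M * ((n + 1) * (y - γ x₀) ^ n)) y := fun y => by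
      refine ((hasDerivAt_sum_div_factorial_mul_sub_pow (fun k => D k x₀) n (γ x₀) y).add
        ((((hasDerivAt_id y).sub_const (γ x₀)).pow (n + 1)).const_mul M)).congr_deriv ?_
      simp [hT']
    have hH : ∀ t ∈ s, HasGDerivAt γ
        (fun t => D 0 t - (T (γ t) + M * (γ t - γ x₀) ^ (n + 1)))
        (D 1 t - (T' (γ t) + M * ((n + 1) * (γ t - γ x₀) ^ n))) t := fun t ht =>
      have hts := hs.mem_nhds ht
      (hD 0 n.succ_pos t ht).sub ((hq (γ t)).hasGDerivAt_comp (hγc.continuousAt hts)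
        (hγm.eventually_apply_ne hts))
    have hH₀ : D 0 x₀ - (T (γ x₀) + M * (γ x₀ - γ x₀) ^ (n + 1)) = 0 := by
      simp [hT, Finset.sum_range_succ']
    have hHx : D 0 x - (T (γ x) + M * (γ x - γ x₀) ^ (n + 1)) = 0 := sub_eq_zero.2 hM
    obtain ⟨c, hc, hcx₀, hc0⟩ : ∃ c ∈ uIcc x₀ x, c ≠ x₀ ∧
        D 1 c - (T' (γ c) + M * ((n + 1) * (γ c - γ x₀) ^ n)) = 0 := by
      rcases lt_or_gt_of_ne hne with h | h
      · obtain ⟨c, hc, hc0⟩ := exists_hasGDerivAt_eq_zero hs hsc hγm hγc hH hx hx₀ h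
          (hHx.trans hH₀.symm)
        exact ⟨c, uIcc_of_ge h.le ▸ Ioo_subset_Icc_self hc, hc.2.ne, hc0⟩
      · obtain ⟨c, hc, hc0⟩ := exists_hasGDerivAt_eq_zero hs hsc hγm hγc hH hx₀ hx h
          (hH₀.trans hHx.symm)
        exact ⟨c, uIcc_of_le h.le ▸ Ioo_subset_Icc_self hc, hc.1.ne', hc0⟩
    have hcs : c ∈ s := hsc.uIcc_subset hx₀ hx hc
    obtain ⟨ξ, hξ, hDξ⟩ := ih (fun k => D (k + 1)) (fun k hk => hD (k + 1) (by omega)) hcs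
    refine ⟨ξ, uIcc_subset_uIcc left_mem_uIcc hc hξ, ?_⟩
    have hGc : (γ c - γ x₀) ^ n ≠ 0 := pow_ne_zero _ (sub_ne_zero.2 (hγm.injOn.ne hcs hx₀ hcx₀))
    have hMξ : M * (n + 1) = D (n + 1) ξ / (n.factorial : ℝ) := by
      refine mul_right_cancel₀ hGc ?_
      simp only [zero_add] at hDξ
      linear_combination hDξ - hc0
    rw [hM, Nat.factorial_succ, Nat.cast_mul, mul_comm ((n + 1 : ℕ) : ℝ), ← div_div, ← hMξ,
      Nat.cast_succ, mul_div_cancel_right₀ _ (by positivity)]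

/-- Statement 6 (generalized Taylor formula with Lagrange remainder): if `f` is
`(n+1)`-times γ-relative differentiable on a neighborhood of `x₀`, then on some
neighborhood `K` of `x₀` one has
`f(x) = Σ_{k=0}^n f_γ^{(k)}(x₀)/k! (γ(x)-γ(x₀))^k
        + f_γ^{(n+1)}(ξ)/(n+1)! (γ(x)-γ(x₀))^{n+1}` for some `ξ ∈ K`. -/
theorem gamma_taylor_lagrange
    (γ f : ℝ → ℝ) (x₀ : ℝ) (n : ℕ) (u : Set ℝ) (hu : u ∈ 𝓝 x₀)
    (hγm : StrictMonoOn γ u) (hγc : ContinuousOn γ u)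
    (hf : GDiffOn γ f (n + 1) u) :
    ∃ K ∈ 𝓝 x₀, K ⊆ u ∧ ∀ x ∈ K, ∃ ξ ∈ K, ξ ∈ uIcc x₀ x ∧
      f x = (∑ k ∈ Finset.range (n + 1),
          gIter γ f k x₀ / (k.factorial : ℝ) * (γ x - γ x₀) ^ k)
        + gIter γ f (n + 1) ξ / ((n + 1).factorial : ℝ) * (γ x - γ x₀) ^ (n + 1) := by
  obtain ⟨ε, hε, hsub⟩ := Metric.mem_nhds_iff.1 hu
  have hsc : (Metric.ball x₀ ε).OrdConnected := Real.ball_eq_Ioo x₀ ε ▸ ordConnected_Ioo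
  have hx₀ : x₀ ∈ Metric.ball x₀ ε := Metric.mem_ball_self hε
  refine ⟨Metric.ball x₀ ε, Metric.ball_mem_nhds x₀ hε, hsub, fun x hx => ?_⟩
  obtain ⟨ξ, hξ, h⟩ := gamma_taylor_lagrange_of_chain Metric.isOpen_ball hsc (hγm.mono hsub)
    (hγc.mono hsub) hx₀ (n + 1) (gIter γ f) (fun k hk t ht => hf k hk t (hsub ht)) hx
  exact ⟨ξ, hsc.uIcc_subset hx₀ hx hξ, hξ, h⟩
end
end

section
/- Let γ be a continuous strictly increasing function, let r ≥ 1 be an integer, and suppose f is r-times γ-relative differentiable on a neighborhood K of x₀, with f_γ^{(1)}, …, f_γ^{(r)} integrable on K with respect to the Lebesgue–Stieltjes measure λ_γ. Then for every x ∈ K: f(x) − Σ_{k=0}^{r−1} (f_γ^{(k)}(x₀)/k!) (γ(x) − γ(x₀))^k = ∫_{x₀}^{x} f_γ^{(r)}(t) · (γ(x) − γ(t))^{r−1}/(r−1)! dγ(t), where the integral is taken with respect to λ_γ. -/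
open MeasureTheory Filter Set Topology
open scoped ENNReal NNReal

noncomputable section

lemma isOpenEmbedding_of_strictMono {γ : ℝ → ℝ} (hγm : StrictMono γ) (hγc : Continuous γ) :
    IsOpenEmbedding γ := by
  refine .of_continuous_injective_isOpenMap hγc hγm.injective
    (isOpenMap_iff_nhds_le.2 fun x s hs => ?_)
  obtain ⟨l, u, hx, hlu⟩ := mem_nhds_iff_exists_Ioo_subset.1 (mem_map.1 hs)
  refine mem_of_superset (Ioo_mem_nhds (hγm hx.1) (hγm hx.2)) ?_
  rw [← hγc.image_Ioo_of_strictMono hγm, image_subset_iff]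
  exact hlu

/-- The γ-relative derivative of `f` is the derivative of `f ∘ γ⁻¹`. -/
lemma hasGDerivAt_iff_hasDerivAt {γ : ℝ → ℝ} (hγm : StrictMono γ) (hγc : Continuous γ)
    {f : ℝ → ℝ} {L x : ℝ} :
    HasGDerivAt γ f L x ↔ HasDerivAt (f ∘ Function.invFun γ) L (γ x) := by
  have hne : map γ (𝓝[≠] x) = 𝓝[≠] (γ x) := by
    rw [← (isOpenEmbedding_of_strictMono hγm hγc).map_nhdsWithin_preimage_eq]
    congr 2
    ext y
    simp [hγm.injective.eq_iff]
  rw [hasDerivAt_iff_tendsto_slope, ← hne, tendsto_map'_iff, HasGDerivAt]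
  refine tendsto_congr fun y => ?_
  simp [slope_def_field, Function.leftInverse_invFun hγm.injective _]

lemma measurePreserving_restrict_Ioc {γ : ℝ → ℝ} (hγm : StrictMono γ) (hγc : Continuous γ)
    {μ : Measure ℝ}
    (hμ : ∀ c d : ℝ, c ≤ d → μ (Ioc c d) = ENNReal.ofReal (γ d - γ c)) (a b : ℝ) :
    MeasurePreserving γ (μ.restrict (Ioc a b)) (volume.restrict (Ioc (γ a) (γ b))) := by
  have hemb := (isOpenEmbedding_of_strictMono hγm hγc).measurableEmbedding
  have hcomap : μ = volume.comap γ := by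
    refine Measure.ext_of_Ioc' _ _ (fun a b hab => ?_) fun a b hab => ?_
    · simp [hμ a b hab.le]
    · rw [hemb.comap_apply, hγc.image_Ioc_of_strictMono hγm, Real.volume_Ioc, hμ a b hab.le]
  have hpre : γ ⁻¹' Ioc (γ a) (γ b) = Ioc a b := by
    ext t
    simp [hγm.lt_iff_lt, hγm.le_iff_le]
  refine ⟨hemb.measurable, ?_⟩
  have hsub : Ioc (γ a) (γ b) ⊆ range γ := by
    rw [← hγc.image_Ioc_of_strictMono hγm]
    exact image_subset_range _ _
  rw [← hpre, ← hemb.restrict_map, hcomap, hemb.map_comap, Measure.restrict_restrict_of_subset hsub]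

/-- The fundamental theorem of calculus for γ-relative derivatives. -/
lemma integral_eq_sub_of_hasGDerivAt {γ : ℝ → ℝ} (hγm : StrictMono γ) (hγc : Continuous γ)
    {μ : Measure ℝ}
    (hμ : ∀ c d : ℝ, c ≤ d → μ (Ioc c d) = ENNReal.ofReal (γ d - γ c))
    {F G : ℝ → ℝ} {a b : ℝ} (hF : ∀ t ∈ uIcc a b, HasGDerivAt γ F (G t) t)
    (hG : IntervalIntegrable G μ a b) :
    ∫ t in a..b, G t ∂μ = F b - F a := by
  have hemb := (isOpenEmbedding_of_strictMono hγm hγc).measurableEmbedding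
  have hinv := Function.leftInverse_invFun hγm.injective
  have hmp := measurePreserving_restrict_Ioc hγm hγc hμ
  have hcomp : (G ∘ Function.invFun γ) ∘ γ = G := by
    ext t
    simp [hinv t]
  have hset (a b : ℝ) : ∫ t in Ioc a b, G t ∂μ
      = ∫ u in Ioc (γ a) (γ b), (G ∘ Function.invFun γ) u := by
    rw [← (hmp a b).integral_comp hemb]
    exact congrArg (fun g => ∫ t in Ioc a b, g t ∂μ) hcomp.symm
  have hint (a b : ℝ) (h : IntegrableOn G (Ioc a b) μ) :
      IntegrableOn (G ∘ Function.invFun γ) (Ioc (γ a) (γ b)) := by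
    rw [IntegrableOn, ← (hmp a b).integrable_comp_emb hemb, hcomp]
    exact h
  have hFTC := intervalIntegral.integral_eq_sub_of_hasDerivAt
    (f := F ∘ Function.invFun γ) (f' := G ∘ Function.invFun γ) (a := γ a) (b := γ b)
    (fun u hu => ?_) ⟨hint _ _ hG.1, hint _ _ hG.2⟩
  · rw [intervalIntegral, hset, hset, ← intervalIntegral, hFTC]
    simp [hinv _]
  · obtain ⟨t, ht, rfl⟩ := intermediate_value_uIcc hγc.continuousOn hu
    simpa [hinv t] using (hasGDerivAt_iff_hasDerivAt hγm hγc).1 (hF t ht)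

/-- Differentiating the Taylor polynomial with respect to its centre telescopes. -/
lemma hasGDerivAt_taylor_sum {γ : ℝ → ℝ} (hγm : StrictMono γ) (hγc : Continuous γ)
    {f : ℝ → ℝ} {n : ℕ} {s : Set ℝ} (hf : GDiffOn γ f (n + 1) s) (X : ℝ) {t : ℝ} (ht : t ∈ s) :
    HasGDerivAt γ
      (fun t => ∑ k ∈ Finset.range (n + 1),
        gIter γ f k t / (k.factorial : ℝ) * (X - γ t) ^ k)
      (gIter γ f (n + 1) t * (X - γ t) ^ n / (n.factorial : ℝ)) t := by
  have hinv := Function.leftInverse_invFun hγm.injective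
  have hγ : HasDerivAt (γ ∘ Function.invFun γ) 1 (γ t) := by
    refine (hasGDerivAt_iff_hasDerivAt hγm hγc).1 (tendsto_const_nhds.congr' ?_)
    filter_upwards [self_mem_nhdsWithin] with y hy
    exact (div_self (sub_ne_zero.2 (hγm.injective.ne hy))).symm
  induction n with
  | zero => simpa [HasGDerivAt] using hf 0 one_pos t ht
  | succ n ih =>
    have ih := ih fun k hk => hf k (hk.trans (Nat.lt_succ_self _))
    have hlast := (hasGDerivAt_iff_hasDerivAt hγm hγc).1 (hf (n + 1) (Nat.lt_succ_self _) t ht)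
    rw [hasGDerivAt_iff_hasDerivAt hγm hγc] at ih ⊢
    have hsum := ih.add ((hlast.div_const ((n + 1).factorial : ℝ)).mul
      ((hγ.const_sub X).pow (n + 1)))
    refine (hsum.congr_deriv ?_).congr_of_eventuallyEq (.of_forall fun u => ?_)
    · simp only [Function.comp_apply, hinv t, Nat.factorial_succ, Pi.pow_apply]
      push_cast
      have := Nat.factorial_ne_zero n
      field_simp
      simp
    · simp [Finset.sum_range_succ _ (n + 1)]

/-- Statement 7 (generalized Taylor formula with integral remainder):
`f(x) - Σ_{k=0}^{r-1} f_γ^{(k)}(x₀)/k! (γ(x)-γ(x₀))^k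
  = ∫_{x₀}^x f_γ^{(r)}(t) (γ(x)-γ(t))^{r-1}/(r-1)! dγ(t)`. -/
theorem gamma_taylor_integral_remainder
    (γ : ℝ → ℝ) (hγm : StrictMono γ) (hγc : Continuous γ)
    (μ : Measure ℝ)
    (hμ : ∀ c d : ℝ, c ≤ d → μ (Ioc c d) = ENNReal.ofReal (γ d - γ c))
    (r : ℕ) (hr : 1 ≤ r) (f : ℝ → ℝ) (x₀ c d : ℝ) (hx₀ : x₀ ∈ Ioo c d)
    (hf : GDiffOn γ f r (Ioo c d))
    (hint : ∀ j, 1 ≤ j → j ≤ r → IntegrableOn (gIter γ f j) (Ioo c d) μ) :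
    ∀ x ∈ Ioo c d,
      f x - ∑ k ∈ Finset.range r,
          gIter γ f k x₀ / (k.factorial : ℝ) * (γ x - γ x₀) ^ k =
        ∫ t in x₀..x,
          gIter γ f r t * (γ x - γ t) ^ (r - 1) / ((r - 1).factorial : ℝ) ∂μ := by
  intro x hx
  obtain ⟨n, rfl⟩ := Nat.exists_eq_add_of_le' hr
  have hsub : uIcc x₀ x ⊆ Ioo c d := ordConnected_Ioo.uIcc_subset hx₀ hx
  have hG : IntervalIntegrable
      (fun t => gIter γ f (n + 1) t * (γ x - γ t) ^ n / (n.factorial : ℝ)) μ x₀ x := by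
    rw [intervalIntegrable_iff]
    have hint' : IntegrableOn (gIter γ f (n + 1)) (uIcc x₀ x) μ :=
      (hint (n + 1) hr le_rfl).mono_set hsub
    have hcont : Continuous fun t => (γ x - γ t) ^ n := by fun_prop
    exact IntegrableOn.mono_set
      ((hint'.mul_continuousOn hcont.continuousOn isCompact_uIcc).div_const _) uIoc_subset_uIcc
  simp only [Nat.add_sub_cancel]
  rw [integral_eq_sub_of_hasGDerivAt hγm hγc hμ
    (fun t ht => hasGDerivAt_taylor_sum hγm hγc hf (γ x) (hsub ht)) hG]
  simp [Finset.sum_range_succ', gIter]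
end
end

section
/- Let r ≥ 1 be an integer and let γ be the piecewise-power function constructed below. If 0 < β_k < 1/r for all k = 1, …, N, then the inverse function γ⁻¹ is r-times differentiable on the open interval (0, γ(a_N + 1)). -/
open MeasureTheory Filter Set Topology
open scoped ENNReal NNReal

noncomputable section

/-- The odd extension of the power function `x ↦ x ^ p` from `[0, ∞)` to `ℝ`. -/
def signedRpow (p x : ℝ) : ℝ := |x| ^ p * Real.sign x

lemma signedRpow_of_nonneg {p x : ℝ} (hp : p ≠ 0) (hx : 0 ≤ x) : signedRpow p x = x ^ p := by
  rcases hx.eq_or_lt with rfl | hx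
  · simp [signedRpow, Real.zero_rpow hp]
  · simp [signedRpow, Real.sign_of_pos hx, abs_of_pos hx]

lemma signedRpow_neg (p x : ℝ) : signedRpow p (-x) = -signedRpow p x := by
  simp [signedRpow, Real.sign_neg]

lemma signedRpow_of_nonpos {p x : ℝ} (hp : p ≠ 0) (hx : x ≤ 0) :
    signedRpow p x = -(-x) ^ p := by
  rw [← signedRpow_of_nonneg hp (neg_nonneg.2 hx), signedRpow_neg, neg_neg]

lemma signedRpow_of_pos {p x : ℝ} (hx : 0 < x) : signedRpow p x = x ^ p := by
  simp [signedRpow, Real.sign_of_pos hx, abs_of_pos hx]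

lemma signedRpow_of_neg {p x : ℝ} (hx : x < 0) : signedRpow p x = -(-x) ^ p := by
  simp [signedRpow, Real.sign_of_neg hx, abs_of_neg hx]

lemma strictMono_signedRpow {p : ℝ} (hp : 0 < p) : StrictMono (signedRpow p) := by
  refine strictMono_of_odd_strictMonoOn_nonneg (signedRpow_neg p) fun x hx y hy hxy => ?_
  rw [signedRpow_of_nonneg hp.ne' hx, signedRpow_of_nonneg hp.ne' hy]
  exact Real.rpow_lt_rpow hx hxy hp

lemma continuous_signedRpow {p : ℝ} (hp : 0 < p) : Continuous (signedRpow p) := by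
  have h : signedRpow p = fun x => if 0 ≤ x then x ^ p else -(-x) ^ p := by
    ext x
    split_ifs with hx
    · exact signedRpow_of_nonneg hp.ne' hx
    · exact signedRpow_of_nonpos hp.ne' (not_le.1 hx).le
  rw [h]
  refine Continuous.if_le ?_ ?_ continuous_const continuous_id ?_
  · exact continuous_id.rpow_const fun _ => Or.inr hp.le
  · exact (continuous_neg.rpow_const fun _ => Or.inr hp.le).neg
  · rintro x rfl
    simp [Real.zero_rpow hp.ne']

lemma signedRpow_signedRpow_inv {p : ℝ} (hp : 0 < p) (x : ℝ) :
    signedRpow p (signedRpow p⁻¹ x) = x := by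
  have key : ∀ x : ℝ, 0 ≤ x → signedRpow p (signedRpow p⁻¹ x) = x := fun x hx => by
    rw [signedRpow_of_nonneg (inv_ne_zero hp.ne') hx,
      signedRpow_of_nonneg hp.ne' (Real.rpow_nonneg hx _), Real.rpow_inv_rpow hx hp.ne']
  rcases le_total 0 x with hx | hx
  · exact key x hx
  · have := key (-x) (neg_nonneg.2 hx)
    rw [signedRpow_neg, signedRpow_neg] at this
    exact neg_injective this

lemma signedRpow_zero (p : ℝ) : signedRpow p 0 = 0 := by simp [signedRpow]

lemma contDiffAt_signedRpow {p x : ℝ} {n : WithTop ℕ∞} (hx : x ≠ 0) :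
    ContDiffAt ℝ n (signedRpow p) x := by
  rcases hx.lt_or_gt with hx | hx
  · have h : ContDiffAt ℝ n (fun y : ℝ => -(-y) ^ p) x :=
      (contDiffAt_id.neg.rpow_const_of_ne (neg_ne_zero.2 hx.ne)).neg
    refine h.congr_of_eventuallyEq ?_
    filter_upwards [Iio_mem_nhds hx] with y hy
    exact signedRpow_of_neg hy
  · have h : ContDiffAt ℝ n (fun y : ℝ => y ^ p) x := contDiffAt_id.rpow_const_of_ne hx.ne'
    refine h.congr_of_eventuallyEq ?_
    filter_upwards [Ioi_mem_nhds hx] with y hy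
    exact signedRpow_of_pos hy

lemma hasDerivAt_signedRpow_of_ne {p x : ℝ} (hx : x ≠ 0) :
    HasDerivAt (signedRpow p) (p * |x| ^ (p - 1)) x := by
  rcases hx.lt_or_gt with hx | hx
  · have h := ((hasDerivAt_neg x).rpow_const (p := p) (Or.inl (neg_ne_zero.2 hx.ne))).neg
    have h' : HasDerivAt (fun y : ℝ => -(-y) ^ p) (p * |x| ^ (p - 1)) x := by
      refine h.congr_deriv ?_
      rw [abs_of_neg hx]
      ring
    refine h'.congr_of_eventuallyEq ?_
    filter_upwards [Iio_mem_nhds hx] with y hy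
    exact signedRpow_of_neg hy
  · have h := Real.hasDerivAt_rpow_const (p := p) (Or.inl hx.ne')
    rw [abs_of_pos hx]
    refine h.congr_of_eventuallyEq ?_
    filter_upwards [Ioi_mem_nhds hx] with y hy
    exact signedRpow_of_pos hy

lemma signedRpow_eq_mul {p x : ℝ} : signedRpow p x = |x| ^ (p - 1) * x := by
  rcases lt_trichotomy x 0 with hx | rfl | hx
  · rw [Real.rpow_sub_one (abs_pos.2 hx.ne).ne', signedRpow, Real.sign_of_neg hx, abs_of_neg hx,
      div_neg, neg_mul, div_mul_cancel₀ _ hx.ne, mul_neg_one]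
  · simp [signedRpow]
  · rw [Real.rpow_sub_one (abs_pos.2 hx.ne').ne', signedRpow, Real.sign_of_pos hx, abs_of_pos hx]
    field_simp

lemma hasDerivAt_signedRpow {p : ℝ} (hp : 1 < p) (x : ℝ) :
    HasDerivAt (signedRpow p) (p * |x| ^ (p - 1)) x := by
  rcases eq_or_ne x 0 with rfl | hx
  · rw [hasDerivAt_iff_tendsto_slope, abs_zero, Real.zero_rpow (sub_pos.2 hp).ne', mul_zero]
    have hc : Tendsto (fun y : ℝ => |y| ^ (p - 1)) (𝓝[≠] 0) (𝓝 0) := by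
      have : Continuous fun y : ℝ => |y| ^ (p - 1) :=
        continuous_abs.rpow_const fun _ => Or.inr (sub_pos.2 hp).le
      simpa [Real.zero_rpow (sub_pos.2 hp).ne'] using (this.tendsto 0).mono_left nhdsWithin_le_nhds
    refine hc.congr' ?_
    filter_upwards [self_mem_nhdsWithin] with y hy
    rw [slope_def_field, signedRpow_zero, sub_zero, sub_zero, signedRpow_eq_mul,
      mul_div_cancel_right₀ _ hy]
  · exact hasDerivAt_signedRpow_of_ne hx

lemma contDiff_abs_rpow_and_signedRpow (n : ℕ) :
    ∀ p : ℝ, (n : ℝ) < p → ContDiff ℝ n (fun x : ℝ => |x| ^ p) ∧ ContDiff ℝ n (signedRpow p) := by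
  induction n with
  | zero =>
    intro p hp
    have hp : 0 < p := by simpa using hp
    simp only [Nat.cast_zero, contDiff_zero]
    exact ⟨continuous_abs.rpow_const fun _ => Or.inr hp.le, continuous_signedRpow hp⟩
  | succ n ih =>
    intro p hp
    push_cast at hp
    have hp1 : 1 < p := lt_of_le_of_lt (by linarith [Nat.cast_nonneg (α := ℝ) n]) hp
    obtain ⟨h₁, h₂⟩ := ih (p - 1) (by linarith)
    have hd₁ : ∀ x : ℝ, HasDerivAt (fun x : ℝ => |x| ^ p) (p * signedRpow (p - 1) x) x := by
      intro x
      convert hasDerivAt_abs_rpow x hp1 using 1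
      rw [signedRpow_eq_mul, mul_assoc, show p - 1 - 1 = p - 2 by ring]
    have hd₂ := hasDerivAt_signedRpow hp1
    push_cast
    rw [contDiff_succ_iff_deriv, contDiff_succ_iff_deriv, deriv_eq hd₁, deriv_eq hd₂]
    exact ⟨⟨fun x => (hd₁ x).differentiableAt, by simp, contDiff_const.mul h₂⟩,
      ⟨fun x => (hd₂ x).differentiableAt, by simp, contDiff_const.mul h₁⟩⟩

lemma contDiff_signedRpow {n : ℕ} {p : ℝ} (hp : (n : ℝ) < p) : ContDiff ℝ n (signedRpow p) :=
  (contDiff_abs_rpow_and_signedRpow n p hp).2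

/-- If `x = P s`, `y = F s` is a `C^n` parametrization of the graph of `g` with `F' ≠ 0` at `s`,
then `g` is `C^n` at `F s`. -/
lemma contDiffAt_of_parametrization {g P F : ℝ → ℝ} {s d : ℝ} {n : WithTop ℕ∞} (hn : n ≠ 0)
    (hP : ContDiffAt ℝ n P s) (hF : ContDiffAt ℝ n F s) (hd : HasDerivAt F d s) (hd0 : d ≠ 0)
    (hg : ∀ᶠ t in 𝓝 s, g (F t) = P t) : ContDiffAt ℝ n g (F s) := by
  have hF' := hd.hasFDerivAt_equiv hd0
  have hS := hF.to_localInverse hF' hn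
  have hs := hF.localInverse_apply_image hF' hn
  have hright : ∀ᶠ y in 𝓝 (F s), F (hF.localInverse hF' hn y) = y :=
    (hF.hasStrictFDerivAt' hF' hn).eventually_right_inverse
  have htend := hS.continuousAt.tendsto
  rw [hs] at htend
  rw [← hs] at hP
  refine (hP.comp (F s) hS).congr_of_eventuallyEq ?_
  filter_upwards [hright, htend.eventually hg] with y hy hgy
  rw [hy] at hgy
  exact hgy

lemma gamma0_eq (N : ℕ) (a β : ℕ → ℝ) (x : ℝ) :
    gamma0 N a β x = (∑ k ∈ Finset.range N, signedRpow (β k) (x - a k))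
      + ∑ k ∈ Finset.range N, a k ^ β k := rfl

section Gamma

variable {N : ℕ} {a β : ℕ → ℝ}

lemma strictMono_gamma0 (hN : 1 ≤ N) (hβ : ∀ k < N, 0 < β k) : StrictMono (gamma0 N a β) := by
  intro x y hxy
  rw [gamma0_eq, gamma0_eq]
  refine add_lt_add_left (Finset.sum_lt_sum_of_nonempty
    (Finset.nonempty_range_iff.2 (by omega)) fun k hk => ?_) _
  exact strictMono_signedRpow (hβ k (Finset.mem_range.1 hk)) (by linarith)

lemma continuous_gamma0 (hβ : ∀ k < N, 0 < β k) : Continuous (gamma0 N a β) := by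
  have h : gamma0 N a β = fun x => (∑ k ∈ Finset.range N, signedRpow (β k) (x - a k))
      + ∑ k ∈ Finset.range N, a k ^ β k := rfl
  rw [h]
  refine (continuous_finsetSum _ fun k hk => ?_).add continuous_const
  exact (continuous_signedRpow (hβ k (Finset.mem_range.1 hk))).comp
    (continuous_id.sub continuous_const)

lemma gammaFun_of_le {x : ℝ} (hx : x ≤ a (N - 1) + 1) : gammaFun N a β x = gamma0 N a β x :=
  if_pos hx

lemma le_last (hmono : ∀ i j, i < j → j < N → a i < a j) {k : ℕ} (hk : k < N) :
    a k ≤ a (N - 1) := by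
  rcases (Nat.le_sub_one_of_lt hk).eq_or_lt with rfl | h
  · exact le_rfl
  · exact (hmono _ _ h (by omega)).le

lemma gamma0_last_add_one (hmono : ∀ i j, i < j → j < N → a i < a j) (hβ : ∀ k < N, 0 < β k) :
    gamma0 N a β (a (N - 1) + 1) = gammaC1 N a β * (a (N - 1) + 1) + gammaC2 N a β := by
  have h : ∑ k ∈ Finset.range N, signedRpow (β k) (a (N - 1) + 1 - a k)
      = ∑ k ∈ Finset.range N, (a (N - 1) + 1 - a k) ^ β k := by
    refine Finset.sum_congr rfl fun k hk => ?_
    have hk := Finset.mem_range.1 hk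
    exact signedRpow_of_nonneg (hβ k hk).ne' (by linarith [le_last hmono hk])
  rw [gamma0_eq, gammaC2, h]
  ring

lemma gammaC1_pos (hN : 1 ≤ N) (hmono : ∀ i j, i < j → j < N → a i < a j)
    (hβ : ∀ k < N, 0 < β k) : 0 < gammaC1 N a β := by
  refine Finset.sum_pos (fun k hk => ?_) (Finset.nonempty_range_iff.2 (by omega))
  have hk := Finset.mem_range.1 hk
  exact mul_pos (hβ k hk) (Real.rpow_pos_of_pos (by linarith [le_last hmono hk]) _)

lemma strictMono_gammaFun (hN : 1 ≤ N) (hmono : ∀ i j, i < j → j < N → a i < a j)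
    (hβ : ∀ k < N, 0 < β k) : StrictMono (gammaFun N a β) := by
  have hIci : ∀ x ∈ Ici (a (N - 1) + 1),
      gammaFun N a β x = gammaC1 N a β * x + gammaC2 N a β := by
    intro x hx
    rcases (mem_Ici.1 hx).eq_or_lt with rfl | hx
    · rw [gammaFun_of_le le_rfl, gamma0_last_add_one hmono hβ]
    · exact if_neg hx.not_ge
  refine StrictMonoOn.Iic_union_Ici (a := a (N - 1) + 1) ?_ ?_
  · intro x hx y hy hxy
    rw [gammaFun_of_le hx, gammaFun_of_le hy]
    exact strictMono_gamma0 hN hβ hxy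
  · intro x hx y hy hxy
    rw [hIci x hx, hIci y hy]
    linarith [mul_lt_mul_of_pos_left hxy (gammaC1_pos hN hmono hβ)]

lemma gamma0_zero (ha : ∀ k < N, 0 < a k) (hβ : ∀ k < N, 0 < β k) : gamma0 N a β 0 = 0 := by
  rw [gamma0_eq, ← Finset.sum_add_distrib]
  refine Finset.sum_eq_zero fun k hk => ?_
  have hk := Finset.mem_range.1 hk
  rw [zero_sub, signedRpow_neg, signedRpow_of_nonneg (hβ k hk).ne' (ha k hk).le]
  ring

lemma gammaInv_gammaFun (hN : 1 ≤ N) (hmono : ∀ i j, i < j → j < N → a i < a j)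
    (hβ : ∀ k < N, 0 < β k) {x : ℝ} (hx : 0 ≤ x) :
    gammaInv (gammaFun N a β) (gammaFun N a β x) = x :=
  (strictMono_gammaFun hN hmono hβ).injective.injOn.leftInvOn_invFunOn hx

/-- Near every interior point `x` there is a `C^r` parametrization `P` through `x` that makes
`gamma0 ∘ P` a `C^r` function with nonzero derivative. -/
lemma exists_parametrization_gamma0 {r : ℕ} (hr : 1 ≤ r) (hN : 1 ≤ N)
    (hmono : ∀ i j, i < j → j < N → a i < a j) (hβ : ∀ k < N, 0 < β k ∧ β k < 1 / (r : ℝ))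
    (x : ℝ) :
    ∃ (P : ℝ → ℝ) (s d : ℝ), P s = x ∧ d ≠ 0 ∧ ContDiffAt ℝ r P s ∧
      ContDiffAt ℝ r (fun t => gamma0 N a β (P t)) s ∧
      HasDerivAt (fun t => gamma0 N a β (P t)) d s := by
  have hinj : ∀ j < N, ∀ k < N, k ≠ j → a j - a k ≠ 0 := by
    intro j hj k hk hkj
    rcases hkj.lt_or_gt with h | h
    · exact (sub_pos.2 (hmono _ _ h hj)).ne'
    · exact (sub_neg.2 (hmono _ _ h hk)).ne
  simp only [gamma0_eq]
  by_cases hx : ∃ j < N, x = a j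
  · obtain ⟨j, hj, rfl⟩ := hx
    have hr0 : (0 : ℝ) < r := by exact_mod_cast hr
    have hβr : (r : ℝ) < (β j)⁻¹ := by
      rw [lt_inv_comm₀ hr0 (hβ j hj).1, ← one_div]
      exact (hβ j hj).2
    have hβ1 : 1 < (β j)⁻¹ := lt_of_le_of_lt (by exact_mod_cast hr) hβr
    have hP : ContDiff ℝ r (fun t => a j + signedRpow (β j)⁻¹ t) :=
      contDiff_const.add (contDiff_signedRpow hβr)
    have hPd : HasDerivAt (fun t => a j + signedRpow (β j)⁻¹ t) 0 0 := by
      have h := (hasDerivAt_signedRpow hβ1 0).const_add (a j)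
      rwa [abs_zero, Real.zero_rpow (sub_pos.2 hβ1).ne', mul_zero] at h
    have hterm : (fun t => signedRpow (β j) (a j + signedRpow (β j)⁻¹ t - a j)) = id := by
      ext t
      rw [add_sub_cancel_left, signedRpow_signedRpow_inv (hβ j hj).1, id]
    refine ⟨fun t => a j + signedRpow (β j)⁻¹ t, 0, ∑ k ∈ Finset.range N, if k = j then 1 else 0,
      by simp [signedRpow_zero], by simp [hj], hP.contDiffAt, ?_, ?_⟩
    · refine (ContDiffAt.sum fun k hk => ?_).add contDiffAt_const
      rcases eq_or_ne k j with rfl | hkj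
      · rw [hterm]
        exact contDiffAt_id
      · refine ContDiffAt.comp (g := signedRpow (β k)) 0 (contDiffAt_signedRpow ?_)
          (hP.contDiffAt.sub contDiffAt_const)
        simpa [signedRpow_zero] using hinj j hj k (Finset.mem_range.1 hk) hkj
    · refine (HasDerivAt.fun_sum fun k hk => ?_).add_const _
      rcases eq_or_ne k j with rfl | hkj
      · rw [hterm, if_pos rfl]
        exact hasDerivAt_id _
      · rw [if_neg hkj]
        have h := HasDerivAt.comp (h₂ := signedRpow (β k)) 0 (hasDerivAt_signedRpow_of_ne
          (by simpa [signedRpow_zero] using hinj j hj k (Finset.mem_range.1 hk) hkj))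
          (hPd.sub_const (a k))
        rwa [mul_zero] at h
  · push Not at hx
    have hne : ∀ k ∈ Finset.range N, x - a k ≠ 0 := fun k hk =>
      sub_ne_zero.2 (hx k (Finset.mem_range.1 hk))
    refine ⟨fun t => t, x, ∑ k ∈ Finset.range N, β k * |x - a k| ^ (β k - 1), rfl,
      (Finset.sum_pos (fun k hk => ?_) (Finset.nonempty_range_iff.2 (by omega))).ne',
      contDiffAt_id, ?_, ?_⟩
    · exact mul_pos (hβ k (Finset.mem_range.1 hk)).1
        (Real.rpow_pos_of_pos (abs_pos.2 (hne k hk)) _)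
    · refine (ContDiffAt.sum fun k hk => ?_).add contDiffAt_const
      exact ContDiffAt.comp (g := signedRpow (β k)) x (contDiffAt_signedRpow (hne k hk))
        (contDiffAt_id.sub contDiffAt_const)
    · refine (HasDerivAt.fun_sum fun k hk => ?_).add_const _
      exact (hasDerivAt_signedRpow_of_ne (hne k hk)).comp_sub_const x (a k)

lemma contDiffOn_gammaInv {r : ℕ} (hr : 1 ≤ r) (hN : 1 ≤ N) (ha : 0 < a 0)
    (hmono : ∀ i j, i < j → j < N → a i < a j) (hβ : ∀ k < N, 0 < β k ∧ β k < 1 / (r : ℝ)) :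
    ContDiffOn ℝ r (gammaInv (gammaFun N a β)) (Ioo 0 (gammaFun N a β (a (N - 1) + 1))) := by
  have hβ0 : ∀ k < N, 0 < β k := fun k hk => (hβ k hk).1
  have ha' : ∀ k < N, 0 < a k := by
    intro k hk
    rcases k.eq_zero_or_pos with rfl | h
    · exact ha
    · exact ha.trans (hmono 0 k h hk)
  intro y hy
  rw [gammaFun_of_le le_rfl] at hy
  have hlast : (0 : ℝ) ≤ a (N - 1) + 1 := by linarith [ha' (N - 1) (by omega)]
  obtain ⟨x, hx, rfl⟩ : y ∈ gamma0 N a β '' Ioo 0 (a (N - 1) + 1) :=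
    intermediate_value_Ioo hlast (continuous_gamma0 hβ0).continuousOn
      (by rwa [gamma0_zero ha' hβ0])
  obtain ⟨P, s, d, rfl, hd0, hP, hF, hd⟩ := exists_parametrization_gamma0 hr hN hmono hβ x
  refine (contDiffAt_of_parametrization (F := fun t => gamma0 N a β (P t))
    (by exact_mod_cast (by omega : r ≠ 0)) hP hF hd hd0 ?_).contDiffWithinAt
  filter_upwards [hP.continuousAt.eventually (Ioo_mem_nhds hx.1 hx.2)] with t ht
  rw [← gammaFun_of_le ht.2.le, gammaInv_gammaFun hN hmono hβ0 ht.1.le]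

end Gamma

/-- Statement 8: if `0 < β_k < 1/r` for all `k`, then `γ⁻¹` is `r`-times differentiable
on `(0, γ(a_N + 1))`. -/
theorem gammaInv_differentiable
    (r : ℕ) (hr : 1 ≤ r) (N : ℕ) (hN : 1 ≤ N) (a β : ℕ → ℝ) (ha : 0 < a 0)
    (hmono : ∀ i j, i < j → j < N → a i < a j)
    (hβ : ∀ k < N, 0 < β k ∧ β k < 1 / (r : ℝ)) :
    ∀ k < r, DifferentiableOn ℝ
      (iteratedDerivWithin k (gammaInv (gammaFun N a β))
        (Ioo 0 (gammaFun N a β (a (N - 1) + 1))))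
      (Ioo 0 (gammaFun N a β (a (N - 1) + 1))) := by
  intro k hk
  exact (contDiffOn_gammaInv hr hN ha hmono hβ).differentiableOn_iteratedDerivWithin
    (by exact_mod_cast hk) isOpen_Ioo.uniqueDiffOn

end
end

section
/- Let γ be the piecewise-power function constructed below with exponents β_k ∈ (0, 1). Then for every 0 ≤ x ≤ a₁ one has (Σ_{k=1}^N β_k a_k^{β_k − 1}) · x ≤ γ(x) ≤ (γ(a₁)/a₁) · x. -/
open MeasureTheory Filter Set Topology
open scoped ENNReal NNReal

noncomputable section

/-- To the left of the first node, `γ` is a sum of reflected powers. -/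
theorem gammaFun_eq_sum_sub {N : ℕ} (hN : 1 ≤ N) {a β : ℕ → ℝ}
    (hle : ∀ k < N, a 0 ≤ a k) (hβ : ∀ k < N, 0 < β k) {x : ℝ} (hx : x ≤ a 0) :
    gammaFun N a β x = ∑ k ∈ Finset.range N, (a k ^ β k - (a k - x) ^ β k) := by
  have hlast := hle (N - 1) (by omega)
  rw [gammaFun, if_pos (by linarith), gamma0, ← Finset.sum_add_distrib]
  refine Finset.sum_congr rfl fun k hk => ?_
  have hkN := Finset.mem_range.1 hk
  rcases (hx.trans (hle k hkN)).lt_or_eq with h | h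
  · rw [Real.sign_of_neg (sub_neg.2 h), abs_of_neg (sub_neg.2 h), neg_sub]
    ring
  · simp [h, Real.zero_rpow (hβ k hkN).ne']

/-- The graph of `y ↦ y ^ b`, for `0 ≤ b ≤ 1`, lies below its tangent line at `c`. -/
theorem mul_rpow_sub_one_mul_le_rpow_sub_rpow {b c x : ℝ} (hb₀ : 0 ≤ b) (hb₁ : b ≤ 1)
    (hc : 0 < c) (hxc : x ≤ c) : b * c ^ (b - 1) * x ≤ c ^ b - (c - x) ^ b := by
  have hs : -1 ≤ -(x / c) := neg_le_neg ((div_le_one hc).2 hxc)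
  have h := rpow_one_add_le_one_add_mul_self hs hb₀ hb₁
  have hfactor : c - x = c * (1 + -(x / c)) := by field_simp; ring
  rw [hfactor, Real.mul_rpow hc.le (by linarith), Real.rpow_sub_one hc.ne']
  calc b * (c ^ b / c) * x = c ^ b - c ^ b * (1 + b * -(x / c)) := by ring
    _ ≤ _ := by gcongr

/-- The function `x ↦ c ^ b - (c - x) ^ b`, for `0 ≤ b ≤ 1`, lies below its chord over `[0, d]`. -/
theorem rpow_sub_rpow_le_div_mul {b c d x : ℝ} (hb₀ : 0 ≤ b) (hb₁ : b ≤ 1)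
    (hd : 0 < d) (hdc : d ≤ c) (hx : 0 ≤ x) (hxd : x ≤ d) :
    c ^ b - (c - x) ^ b ≤ (c ^ b - (c - d) ^ b) / d * x := by
  have h := (Real.concaveOn_rpow hb₀ hb₁).2 (Set.mem_Ici.2 (hd.le.trans hdc))
    (Set.mem_Ici.2 (sub_nonneg.2 hdc)) (sub_nonneg.2 ((div_le_one hd).2 hxd))
    (div_nonneg hx hd.le) (sub_add_cancel 1 (x / d))
  have hcomb : (1 - x / d) * c + x / d * (c - d) = c - x := by field_simp; ring
  simp only [smul_eq_mul] at h
  rw [hcomb] at h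
  calc c ^ b - (c - x) ^ b ≤ c ^ b - ((1 - x / d) * c ^ b + x / d * (c - d) ^ b) := by gcongr
    _ = _ := by ring

/-- Statement 9: for `0 ≤ x ≤ a₁` one has
`(Σ_k β_k a_k^{β_k - 1}) x ≤ γ(x) ≤ (γ(a₁)/a₁) x`. -/
theorem gammaFun_bounds
    (N : ℕ) (hN : 1 ≤ N) (a β : ℕ → ℝ) (ha : 0 < a 0)
    (hmono : ∀ i j, i < j → j < N → a i < a j)
    (hβ : ∀ k < N, 0 < β k ∧ β k < 1) :
    ∀ x ∈ Icc (0 : ℝ) (a 0),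
      (∑ k ∈ Finset.range N, β k * a k ^ (β k - 1)) * x ≤ gammaFun N a β x ∧
        gammaFun N a β x ≤ gammaFun N a β (a 0) / a 0 * x := by
  intro x hx
  have hle : ∀ k < N, a 0 ≤ a k := fun k hk => by
    rcases k.eq_zero_or_pos with rfl | hpos
    · exact le_rfl
    · exact (hmono 0 k hpos hk).le
  have hβ₀ : ∀ k < N, 0 < β k := fun k hk => (hβ k hk).1
  rw [gammaFun_eq_sum_sub hN hle hβ₀ hx.2, gammaFun_eq_sum_sub hN hle hβ₀ le_rfl,
    Finset.sum_div, Finset.sum_mul, Finset.sum_mul]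
  constructor <;> refine Finset.sum_le_sum fun k hk => ?_
  all_goals
    have hkN := Finset.mem_range.1 hk
    have hak := hle k hkN
    obtain ⟨hb₀, hb₁⟩ := hβ k hkN
  · exact mul_rpow_sub_one_mul_le_rpow_sub_rpow hb₀.le hb₁.le (ha.trans_le hak) (hx.2.trans hak)
  · exact rpow_sub_rpow_le_div_mul hb₀.le hb₁.le ha hak hx.1 hx.2

end
end
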